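/- Let 𝓜 be a moon polyomino with columns c_1,…,c_m, s=(s_1,…,s_m) a tuple of nonnegative integers, and A a set of rows of 𝓜. Let σ be a permutation of {1,…,m} such that the shape 𝓝 whose columns from left to right are c'_i = c_{σ(i)} is also a moon polyomino, let s'_i = s_{σ(i)}, and let A' be a set of rows of 𝓝 whose multiset of row lengths equals the multiset of row lengths of the rows in A (such A' exists since 𝓜 and 𝓝 have the same multiset of row lengths). Then Σ_{M∈F(𝓜,s;A)} q^{maj(M)} = Σ_{N∈F(𝓝,s';A')} q^{maj(N)}; that is, the generating function of the major index does not depend on the order of the columns of 𝓜. -/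

import Mathlib

open Polynomial

namespace MoonPolyomino

/-- A cell `(r, c)` of `ℤ²`: `r` is the row index (rows increase downwards)
and `c` is the column index (columns increase to the right). -/
abbrev Cell : Type := ℤ × ℤ

/-- The set of (indices of) rows of a polyomino. -/
def rowSet (P : Finset Cell) : Finset ℤ := P.image Prod.fst

/-- The set of (indices of) columns of a polyomino. -/
def colSet (P : Finset Cell) : Finset ℤ := P.image Prod.snd

/-- The length of row `r` of `P`. -/
def rowLen (P : Finset Cell) (r : ℤ) : ℕ := (P.filter fun x => x.1 = r).card

/-- The length of column `c` of `P`. -/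
def colLen (P : Finset Cell) (c : ℤ) : ℕ := (P.filter fun x => x.2 = c).card

def RowConvex (P : Finset Cell) : Prop :=
  ∀ r c₁ c₂ c : ℤ, (r, c₁) ∈ P → (r, c₂) ∈ P → c₁ ≤ c → c ≤ c₂ → (r, c) ∈ P

def ColConvex (P : Finset Cell) : Prop :=
  ∀ c r₁ r₂ r : ℤ, (r₁, c) ∈ P → (r₂, c) ∈ P → r₁ ≤ r → r ≤ r₂ → (r, c) ∈ P

/-- Any two columns are comparable (the rows met by one form a subset of those met
by the other). -/
def IntersectionFree (P : Finset Cell) : Prop :=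
  ∀ c₁ c₂ : ℤ, (∀ r : ℤ, (r, c₁) ∈ P → (r, c₂) ∈ P) ∨ (∀ r : ℤ, (r, c₂) ∈ P → (r, c₁) ∈ P)

/-- A moon polyomino: a convex intersection-free polyomino. -/
def IsMoon (P : Finset Cell) : Prop := RowConvex P ∧ ColConvex P ∧ IntersectionFree P

/-- A left-aligned stack polyomino: all rows have their leftmost cell in the same column. -/
def LeftAligned (P : Finset Cell) : Prop := ∃ c₀ : ℤ, ∀ x ∈ P, c₀ ≤ x.2 ∧ (x.1, c₀) ∈ P

/-- A top-aligned stack polyomino: all columns have their topmost cell in the same row. -/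
def TopAligned (P : Finset Cell) : Prop := ∃ r₀ : ℤ, ∀ x ∈ P, r₀ ≤ x.1 ∧ (r₀, x.2) ∈ P

/-- A 01-filling of `P`, identified with its set `M` of 1-cells: at most one 1 in each row. -/
def IsFilling (P M : Finset Cell) : Prop :=
  M ⊆ P ∧ ∀ x ∈ M, ∀ y ∈ M, x.1 = y.1 → x = y

open scoped Classical in
/-- `F(𝓜, s; A)`: the 01-fillings of `P` in which column `c` contains exactly `s c` ones
and whose empty rows are exactly the rows in `A`. -/
noncomputable def FillSet (P : Finset Cell) (s : ℤ → ℕ) (A : Finset ℤ) :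
    Finset (Finset Cell) :=
  P.powerset.filter fun M =>
    (∀ x ∈ M, ∀ y ∈ M, x.1 = y.1 → x = y) ∧
    (∀ c ∈ colSet P, (M.filter fun x => x.2 = c).card = s c) ∧
    (∀ r ∈ rowSet P, (r ∈ A ↔ ∀ x ∈ M, x.1 ≠ r))

open scoped Classical in
/-- `ne(M)`: the number of north-east chains, i.e. pairs of 1-cells, one strictly above and
strictly to the right of the other, such that the smallest rectangle containing both lies
in `P`.  In a pair `p`, `p.1` is the lower-left cell and `p.2` the upper-right one. -/
noncomputable def neP (P M : Finset Cell) : ℕ :=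
  ((M ×ˢ M).filter fun p =>
      p.2.1 < p.1.1 ∧ p.1.2 < p.2.2 ∧
      ∀ a b : ℤ, p.2.1 ≤ a → a ≤ p.1.1 → p.1.2 ≤ b → b ≤ p.2.2 → (a, b) ∈ P).card

open scoped Classical in
/-- The descent statistic of a rectangular filling `M`: the number of pairs of 1-cells lying
in consecutive nonempty rows and forming a north-east chain (`p.1` is the cell in the upper
of the two rows, `p.2` the one in the next nonempty row below it). -/
noncomputable def desR (M : Finset Cell) : ℕ :=
  ((M ×ˢ M).filter fun p =>
      p.1.1 < p.2.1 ∧ p.2.2 < p.1.2 ∧ ∀ z ∈ M, ¬ (p.1.1 < z.1 ∧ z.1 < p.2.1)).card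

/-- The major index of a rectangular filling `M`: the sum, over the nonempty rows `r`,
of the descent statistic of the restriction of `M` to row `r` and the rows above it. -/
noncomputable def majR (M : Finset Cell) : ℕ :=
  ∑ y ∈ M, desR (M.filter fun x => x.1 ≤ y.1)

/-- `R` is a (nonempty) combinatorial rectangle. -/
def IsRect (R : Finset Cell) : Prop :=
  ∃ r₁ r₂ c₁ c₂ : ℤ, r₁ ≤ r₂ ∧ c₁ ≤ c₂ ∧ R = Finset.Icc r₁ r₂ ×ˢ Finset.Icc c₁ c₂

/-- `R` is a maximal rectangle contained in `P`. -/
def IsMaxRect (P R : Finset Cell) : Prop :=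
  IsRect R ∧ R ⊆ P ∧ ∀ R' : Finset Cell, IsRect R' → R' ⊆ P → R ⊆ R' → R' = R

open scoped Classical in
/-- The set of maximal rectangles contained in `P`. -/
noncomputable def maxRects (P : Finset Cell) : Finset (Finset Cell) :=
  P.powerset.filter fun R => IsMaxRect P R

/-- The height (number of rows) of a rectangle. -/
def nRows (R : Finset Cell) : ℕ := (R.image Prod.fst).card

open scoped Classical in
/-- The major index of a filling `M` of a moon polyomino `P`:
`maj(M) = Σᵢ maj(Rᵢ) − Σᵢ maj(Rᵢ ∩ Rᵢ₊₁)`, where `R₁, …, R_r` are the restrictions of `M`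
to the maximal rectangles of `P` listed in increasing order of height (in a moon polyomino
the maximal rectangles have pairwise distinct heights; the consecutive pairs are exactly
the pairs of maximal rectangles with no maximal rectangle of intermediate height). -/
noncomputable def majP (P M : Finset Cell) : ℕ :=
  (∑ R ∈ maxRects P, majR (M ∩ R)) -
    ∑ p ∈ (maxRects P ×ˢ maxRects P).filter
        (fun p => nRows p.1 < nRows p.2 ∧
          ∀ T ∈ maxRects P, ¬ (nRows p.1 < nRows T ∧ nRows T < nRows p.2)),
      majR (M ∩ p.1 ∩ p.2)

/-- `c` belongs to the right part `Right(𝓜)` of `P`: every column strictly to its right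
is at most as long as `c`. -/
def InRightPart (P : Finset Cell) (c : ℤ) : Prop :=
  ∀ d ∈ colSet P, c < d → colLen P d ≤ colLen P c

/-- The total order `≺` on the columns of a moon polyomino. -/
def colPrec (P : Finset Cell) (c d : ℤ) : Prop :=
  colLen P c < colLen P d ∨
    (colLen P c = colLen P d ∧
      ((¬ InRightPart P c ∧ InRightPart P d) ∨
       (¬ InRightPart P c ∧ ¬ InRightPart P d ∧ c < d) ∨
       (InRightPart P c ∧ InRightPart P d ∧ d < c)))

open scoped Classical in
/-- `h_c = |c| − a_c − Σ_{d ≺ c} s_d`, where `a_c` is the number of rows of `A`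
meeting column `c`. -/
noncomputable def hVal (P : Finset Cell) (s : ℤ → ℕ) (A : Finset ℤ) (c : ℤ) : ℤ :=
  (colLen P c : ℤ) - ((A.filter fun r => (r, c) ∈ P).card : ℤ)
    - ∑ d ∈ (colSet P).filter (fun d => colPrec P d c), (s d : ℤ)

open scoped Classical in
/-- The Gaussian binomial coefficient
`[h choose s]_q = Σ_{0 ≤ i₁ ≤ ⋯ ≤ i_s ≤ h−s} q^{i₁+⋯+i_s}` as a polynomial in `q = X`. -/
noncomputable def gaussBinom (h : ℤ) (s : ℕ) : Polynomial ℤ :=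
  ∑ f ∈ (Fintype.piFinset fun _ : Fin s => Finset.Icc (0 : ℤ) (h - s)).filter
      (fun f => Monotone f),
    Polynomial.X ^ (∑ i, f i).toNat

/-- The major index of a word: `maj(w) = Σ_{i ∈ Des(w)} i` (positions are 1-based). -/
def majW (w : List ℕ) : ℕ :=
  ∑ i ∈ Finset.range (w.length - 1), if w.getD (i + 1) 0 < w.getD i 0 then i + 1 else 0

/-- The descent number of a word. -/
def desW (w : List ℕ) : ℕ :=
  ∑ i ∈ Finset.range (w.length - 1), if w.getD (i + 1) 0 < w.getD i 0 then 1 else 0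

/-- `w'` is obtained from `w` by inserting `m` copies of the letter `a` (where `a` does not
occur in `w`): `w'` has length `k + m`, exactly `m` letters equal to `a`, and its
subsequence of letters different from `a` is `w`. -/
def IsInsertion (w : List ℕ) (a m : ℕ) (w' : List ℕ) : Prop :=
  w'.length = w.length + m ∧ w'.count a = m ∧ w'.filter (fun x => decide (x ≠ a)) = w

open scoped Classical in
/-- The weakly increasing `m`-tuples `0 ≤ i₁ ≤ ⋯ ≤ i_m ≤ k`. -/
noncomputable def monoTuples (m k : ℕ) : Finset (Fin m → ℕ) :=
  (Fintype.piFinset fun _ : Fin m => Finset.range (k + 1)).filter fun f => Monotone f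


/-! ### Words -/

/-- major index of a word (descents weighted by the number of letters to the right) -/
def wmaj : List ℤ → ℕ
  | [] => 0
  | [_] => 0
  | x :: y :: l => wmaj (y :: l) + if y < x then l.length + 1 else 0

theorem wmaj_delete (p b : ℤ) (l : List ℤ) : wmaj (p :: l) ≤ wmaj (p :: b :: l) := by
  cases l with
  | nil => simp [wmaj]
  | cons z l =>
    simp only [wmaj, List.length_cons]
    split_ifs <;> omega

theorem wmaj_cons_le (p : ℤ) (l : List ℤ) : wmaj l ≤ wmaj (p :: l) := by
  cases l with
  | nil => simp [wmaj]
  | cons z l => simp [wmaj]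

theorem wmaj_sublist_aux {l₁ l₂ : List ℤ} (h : l₁.Sublist l₂) :
    ∀ p : ℤ, wmaj (p :: l₁) ≤ wmaj (p :: l₂) := by
  induction h with
  | slnil => intro p; exact le_rfl
  | cons b h ih => intro p; exact (ih p).trans (wmaj_delete p b _)
  | cons_cons b h ih =>
    intro p
    have h1 := ih b
    have h2 := h.length_le
    simp only [wmaj]
    split_ifs <;> omega

theorem wmaj_sublist {l₁ l₂ : List ℤ} (h : l₁.Sublist l₂) : wmaj l₁ ≤ wmaj l₂ := by
  induction h with
  | slnil => exact le_rfl
  | cons b h ih => exact ih.trans (wmaj_cons_le b _)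
  | cons_cons b h ih => exact wmaj_sublist_aux h b

/-- `gb q k s` is the Gaussian binomial `[k+s choose s]_q`. -/
def gb {R : Type*} [CommRing R] (q : R) : ℕ → ℕ → R
  | 0, _ => 1
  | _ + 1, 0 => 1
  | k + 1, s + 1 => gb q (k + 1) s + q ^ (s + 1) * gb q k (s + 1)

theorem gb_zero_right {R : Type*} [CommRing R] (q : R) (k : ℕ) : gb q k 0 = 1 := by
  cases k <;> simp [gb]

theorem gb_zero_left {R : Type*} [CommRing R] (q : R) (k : ℕ) : gb q 0 k = 1 := by
  simp [gb]

theorem gb_succ {R : Type*} [CommRing R] (q : R) (k s : ℕ) :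
    gb q (k + 1) (s + 1) = gb q (k + 1) s + q ^ (s + 1) * gb q k (s + 1) := by
  rw [gb]

theorem gb_rel {R : Type*} [CommRing R] (q : R) : ∀ n k s : ℕ, k + s = n →
    gb q (k + 1) s * (1 - q ^ (k + 1)) = gb q k (s + 1) * (1 - q ^ (s + 1)) := by
  intro n
  induction n with
  | zero =>
    intro k s h
    obtain rfl : k = 0 := by omega
    obtain rfl : s = 0 := by omega
    simp [gb]
  | succ n ih =>
    intro k s h
    have e1 : gb q (k + 1) s * (1 - q ^ (k + 1)) = gb q k s * (1 - q ^ (k + s + 1)) := by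
      cases s with
      | zero => simp [gb_zero_right]
      | succ s =>
        have := ih k s (by omega)
        rw [gb_succ, add_mul, this]; ring
    have e2 : gb q k (s + 1) * (1 - q ^ (s + 1)) = gb q k s * (1 - q ^ (k + s + 1)) := by
      cases k with
      | zero => simp [gb_zero_left]
      | succ k =>
        have := ih k s (by omega)
        rw [gb_succ, add_mul, mul_assoc, ← this]; ring
    rw [e1, e2]

theorem gb_succ' {R : Type*} [CommRing R] (q : R) (k s : ℕ) :
    gb q (k + 1) (s + 1) = q ^ (k + 1) * gb q (k + 1) s + gb q k (s + 1) := by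
  have := gb_rel q _ k s rfl
  rw [gb_succ]
  linear_combination this

/-- all insertions of `s` copies of `c` in a word -/
def ins (c : ℤ) : List ℤ → ℕ → Finset (List ℤ)
  | [], s => {List.replicate s c}
  | x :: u, 0 => {x :: u}
  | x :: u, s + 1 => (ins c (x :: u) s).image (fun v => c :: v) ∪
      (ins c u (s + 1)).image (fun v => x :: v)

theorem ins_zero (c : ℤ) (w : List ℤ) : ins c w 0 = {w} := by
  cases w <;> simp [ins]

theorem mem_ins (c : ℤ) (v : List ℤ) : ∀ (w : List ℤ) (s : ℕ), c ∉ w →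
    (v ∈ ins c w s ↔ v.filter (fun x => decide (x ≠ c)) = w ∧ v.count c = s) := by
  induction v with
  | nil =>
    intro w s hw
    cases w with
    | nil => cases s <;> simp [ins, List.replicate_succ]
    | cons x u => cases s <;> simp [ins]
  | cons y v ih =>
    intro w s hw
    cases w with
    | nil =>
      rw [ins, Finset.mem_singleton, List.eq_replicate_iff, List.filter_eq_nil_iff]
      constructor
      · rintro ⟨h1, h2⟩
        refine ⟨fun a ha => by simp [h2 a ha], ?_⟩
        rw [← h1, List.count_eq_length]
        intro b hb; exact (h2 b hb).symm
      · rintro ⟨h1, h2⟩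
        have h3 : ∀ b ∈ y :: v, b = c := fun b hb => by simpa using h1 b hb
        refine ⟨?_, h3⟩
        rw [← h2, List.count_eq_length.2]
        intro b hb; exact (h3 b hb).symm
    | cons x u =>
      have hx : c ≠ x := fun h => hw (by simp [h])
      have hu : c ∉ u := fun h => hw (by simp [h])
      cases s with
      | zero =>
        rw [ins, Finset.mem_singleton]
        constructor
        · intro h
          rw [h]
          refine ⟨List.filter_eq_self.2 ?_, List.count_eq_zero.2 hw⟩
          intro a ha
          simp only [decide_eq_true_eq]
          rintro rfl; exact hw ha
        · rintro ⟨h1, h2⟩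
          rw [← h1, eq_comm, List.filter_eq_self]
          intro a ha
          simp only [decide_eq_true_eq]
          rintro rfl; exact (List.count_eq_zero.1 h2) ha
      | succ s =>
        rw [ins, Finset.mem_union, Finset.mem_image, Finset.mem_image]
        by_cases hy : y = c
        · subst hy
          simp only [List.cons.injEq, true_and, exists_eq_right, ih _ _ hw, hx.symm, false_and,
            and_false, exists_false, or_false]
          simp
        · simp only [List.cons.injEq, Ne.symm hy, false_and, and_false, exists_false, false_or]
          rw [List.filter_cons_of_pos (by simpa using hy), List.count_cons_of_ne hy]
          simp only [List.cons.injEq]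
          constructor
          · rintro ⟨a, h1, h2, rfl⟩
            have := (ih _ _ hu).1 h1
            exact ⟨⟨h2.symm, this.1⟩, this.2⟩
          · rintro ⟨⟨h1, h2⟩, h3⟩
            exact ⟨v, (ih _ _ hu).2 ⟨h2, h3⟩, h1.symm, rfl⟩

theorem length_of_mem_ins (c : ℤ) (w : List ℤ) (s : ℕ) (v : List ℤ) (h : c ∉ w)
    (hv : v ∈ ins c w s) : v.length = w.length + s := by
  rw [mem_ins _ _ _ _ h] at hv
  obtain ⟨rfl, rfl⟩ := hv
  induction v with
  | nil => rfl
  | cons y v ih =>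
    have ih := ih (by simp)
    by_cases hy : y = c
    · subst hy; simp at ih ⊢; omega
    · rw [List.filter_cons_of_pos (by simpa using hy), List.count_cons_of_ne hy]
      simp only [List.length_cons]; omega

theorem sum_ins_succ {R : Type*} [CommRing R] (c x : ℤ) (u : List ℤ) (s : ℕ) (hx : c ≠ x)
    (f : List ℤ → R) :
    ∑ v ∈ ins c (x :: u) (s + 1), f v
      = ∑ v ∈ ins c (x :: u) s, f (c :: v) + ∑ v ∈ ins c u (s + 1), f (x :: v) := by
  rw [ins, Finset.sum_union, Finset.sum_image, Finset.sum_image]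
  · intro a _ b _ h; simpa using h
  · intro a _ b _ h; simpa using h
  · rw [Finset.disjoint_left]
    intro a ha hb
    rw [Finset.mem_image] at ha hb
    obtain ⟨v, _, rfl⟩ := ha
    obtain ⟨v', _, h⟩ := hb
    simp only [List.cons.injEq] at h
    exact hx h.1.symm

theorem wmaj_cons_cons (x y : ℤ) (l : List ℤ) :
    wmaj (x :: y :: l) = wmaj (y :: l) + if y < x then l.length + 1 else 0 := by rw [wmaj]

theorem wmaj_replicate (c : ℤ) (s : ℕ) : wmaj (List.replicate s c) = 0 := by
  induction s with
  | zero => rfl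
  | succ s ih =>
    cases s with
    | zero => rfl
    | succ s => simp only [List.replicate_succ] at ih ⊢; rw [wmaj_cons_cons, ih]; simp

theorem sum_D_succ {R : Type*} [CommRing R] (q : R) (c p x : ℤ) (u : List ℤ) (s : ℕ)
    (h : c ∉ x :: u) :
    ∑ v ∈ ins c (x :: u) (s + 1), q ^ wmaj (p :: v)
      = q ^ (if c < p then u.length + s + 2 else 0) * ∑ v ∈ ins c (x :: u) s, q ^ wmaj (c :: v)
        + q ^ (if x < p then u.length + s + 2 else 0) *
          ∑ v ∈ ins c u (s + 1), q ^ wmaj (x :: v) := by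
  have hx : c ≠ x := fun h' => h (by simp [h'])
  have hu : c ∉ u := fun h' => h (by simp [h'])
  rw [sum_ins_succ c x u s hx, Finset.mul_sum, Finset.mul_sum]
  congr 1
  · refine Finset.sum_congr rfl fun v hv => ?_
    have := length_of_mem_ins _ _ _ _ h hv
    rw [wmaj_cons_cons, this, ← pow_add, add_comm]
    congr 2
    simp only [List.length_cons]
    split_ifs <;> omega
  · refine Finset.sum_congr rfl fun v hv => ?_
    have := length_of_mem_ins _ _ _ _ hu hv
    rw [wmaj_cons_cons, this, ← pow_add, add_comm]
    congr 2

/-- The refined insertion lemma. -/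
theorem sum_D {R : Type*} [CommRing R] (q : R) (c : ℤ) : ∀ (w : List ℤ), c ∉ w → ∀ s : ℕ,
    (∀ p, p ≠ c → ∑ v ∈ ins c w s, q ^ wmaj (p :: v)
      = q ^ wmaj (p :: w) * gb q w.length s * q ^ (if c < p then s else 0)) ∧
    (∑ v ∈ ins c w s, q ^ wmaj (c :: v)
      = q ^ wmaj w * gb q w.length s * q ^ (if w.headD c < c then w.length else 0)) := by
  intro w
  induction w with
  | nil =>
    intro _ s
    simp only [ins, Finset.sum_singleton, List.length_nil, gb_zero_left]
    refine ⟨fun p hp => ?_, ?_⟩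
    · cases s with
      | zero => simp [wmaj]
      | succ s =>
        have := wmaj_replicate c (s + 1)
        rw [List.replicate_succ] at this ⊢
        rw [wmaj_cons_cons, this]
        simp [wmaj]
    · have := wmaj_replicate c (s + 1)
      rw [List.replicate_succ] at this
      simp [this, wmaj]
  | cons x u ihw =>
    intro hw s
    have hx : c ≠ x := fun h' => hw (by simp [h'])
    have hu : c ∉ u := fun h' => hw (by simp [h'])
    induction s with
    | zero =>
      simp only [ins_zero, Finset.sum_singleton, gb_zero_right, List.headD_cons]
      refine ⟨fun p hp => by simp, ?_⟩
      rw [wmaj_cons_cons, pow_add]; by_cases hh : x < c <;> simp [hh]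
    | succ s ihs =>
      have hN := (ihw hu (s + 1)).1 x hx.symm
      have hC := ihs.2
      simp only [List.headD_cons, List.length_cons] at hC ⊢
      have key : ∀ p, ∑ v ∈ ins c (x :: u) (s + 1), q ^ wmaj (p :: v) = _ :=
        fun p => sum_D_succ q c p x u s hw
      have g1 := gb_succ q u.length s
      have g2 := gb_succ' q u.length s
      refine ⟨fun p hp => ?_, ?_⟩
      · rw [key, hN, hC, wmaj_cons_cons p]
        rcases lt_or_gt_of_ne hx with h1 | h1 <;> rcases lt_or_gt_of_ne hp with h2 | h2
        · -- c < x, p < c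
          have h3 : ¬ x < p := by omega
          have h4 : ¬ c < p := by omega
          have h5 : ¬ x < c := by omega
          simp only [h1, h3, h4, h5, if_true, if_false, pow_zero, g1]
          ring
        · -- c < x, c < p
          have h5 : ¬ x < c := by omega
          by_cases h3 : x < p
          · simp only [h1, h2, h3, h5, if_true, if_false, pow_zero, g1]
            ring
          · simp only [h1, h2, h3, h5, if_true, if_false, pow_zero, g2]
            ring
        · -- x < c, p < c
          have h4 : ¬ c < p := by omega
          have h5 : ¬ c < x := by omega
          by_cases h3 : x < p
          · simp only [h1, h3, h4, h5, if_true, if_false, pow_zero, g1]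
            ring
          · simp only [h1, h3, h4, h5, if_true, if_false, pow_zero, g2]
            ring
        · have h3 : x < p := by omega
          have h5 : ¬ c < x := by omega
          simp only [h1, h2, h3, h5, if_true, if_false, pow_zero, g2]
          ring
      · rw [key, hN, hC]
        rcases lt_or_gt_of_ne hx with h1 | h1
        · have h5 : ¬ x < c := by omega
          simp only [h1, h5, lt_irrefl, if_true, if_false, pow_zero, g1]
          ring
        · have h5 : ¬ c < x := by omega
          simp only [h1, h5, lt_irrefl, if_true, if_false, pow_zero, g1]
          ring

theorem sum_ins {R : Type*} [CommRing R] (q : R) (c : ℤ) (w : List ℤ) (h : c ∉ w) (s : ℕ) :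
    ∑ v ∈ ins c w s, q ^ wmaj v = q ^ wmaj w * gb q w.length s := by
  cases w with
  | nil => simp [ins, wmaj_replicate, gb_zero_left, wmaj]
  | cons x u =>
    have hx : c ≠ x := fun h' => h (by simp [h'])
    have hu : c ∉ u := fun h' => h (by simp [h'])
    cases s with
    | zero => simp [ins_zero, gb_zero_right]
    | succ s =>
      rw [sum_ins_succ c x u s hx, (sum_D q c u hu (s + 1)).1 x hx.symm, (sum_D q c _ h s).2]
      simp only [List.headD_cons, List.length_cons]
      rcases lt_or_gt_of_ne hx with h1 | h1
      · have h5 : ¬ x < c := by omega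
        simp only [h1, h5, if_true, if_false, pow_zero, gb_succ]
        ring
      · have h5 : ¬ c < x := by omega
        simp only [h1, h5, if_true, if_false, pow_zero, gb_succ']
        ring

/-- data of a column: letter, number of copies, number of rows above and below -/
structure Col where
  c : ℤ
  s : ℕ
  a : ℕ
  t : ℕ

def mid (a t : ℕ) (w : List ℤ) : List ℤ := (w.drop a).take (w.length - a - t)

theorem mid_append (u m v : List ℤ) (a t : ℕ) (ha : u.length = a) (ht : v.length = t) :
    mid a t (u ++ m ++ v) = m := by
  subst ha ht
  have h : (u ++ m ++ v).length - u.length - v.length = m.length := by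
    simp only [List.length_append]; omega
  rw [mid, h, List.append_assoc, List.drop_left, List.take_left]

theorem exists_decomp (a t : ℕ) (w : List ℤ) (h : a + t ≤ w.length) :
    w = w.take a ++ mid a t w ++ w.drop (w.length - t) ∧ (w.take a).length = a ∧
      (w.drop (w.length - t)).length = t := by
  refine ⟨?_, by simp; omega, by simp; omega⟩
  rw [mid, List.append_assoc]
  have : w.drop (w.length - t) = (w.drop a).drop (w.length - a - t) := by
    rw [List.drop_drop]; congr 1; omega
  rw [this, List.take_append_drop, List.take_append_drop]

def ne' (c : ℤ) (w : List ℤ) : List ℤ := w.filter (fun x => decide (x ≠ c))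

theorem ne'_eq_self {c : ℤ} {w : List ℤ} (h : c ∉ w) : ne' c w = w := by
  rw [ne', List.filter_eq_self]
  intro a ha
  simp only [decide_eq_true_eq]
  rintro rfl; exact h ha

theorem not_mem_ne' (c : ℤ) (w : List ℤ) : c ∉ ne' c w := by simp [ne']

theorem ne'_append (c : ℤ) (u v : List ℤ) : ne' c (u ++ v) = ne' c u ++ ne' c v := by
  simp [ne']

theorem length_ne' (c : ℤ) (v : List ℤ) : v.length = (ne' c v).length + v.count c :=
  length_of_mem_ins c _ _ _ (not_mem_ne' c v) ((mem_ins c v _ _ (not_mem_ne' c v)).2 ⟨rfl, rfl⟩)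

theorem count_ne' {c d : ℤ} (h : d ≠ c) (w : List ℤ) : (ne' c w).count d = w.count d := by
  rw [ne', List.count_filter (by simpa using h)]

noncomputable def wmajZ : List Col → List ℤ → ℤ
  | [], _ => 0
  | e :: L, w => wmajZ L (ne' e.c w) + wmaj (mid e.a e.t w) - wmaj (ne' e.c (mid e.a e.t w))

def tot (L : List Col) : ℕ := (L.map Col.s).sum

def Good (L : List Col) (w : List ℤ) : Prop :=
  (∀ x ∈ w, x ∈ L.map Col.c) ∧ ∀ e ∈ L, w.count e.c = e.s ∧
    ∃ u m v, w = u ++ m ++ v ∧ u.length = e.a ∧ v.length = e.t ∧ e.c ∉ u ∧ e.c ∉ v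

theorem length_eq_tot (L : List Col) (hL : (L.map Col.c).Nodup) : ∀ w : List ℤ,
    (∀ x ∈ w, x ∈ L.map Col.c) → (∀ e ∈ L, w.count e.c = e.s) → w.length = tot L := by
  induction L with
  | nil =>
    intro w h1 h2
    cases w with
    | nil => rfl
    | cons x w => exact absurd (h1 x (by simp)) (by simp)
  | cons e L ih =>
    intro w h1 h2
    rw [List.map_cons, List.nodup_cons] at hL
    have h3 := ih hL.2 (ne' e.c w) (by
      intro x hx
      simp only [ne', List.mem_filter, decide_eq_true_eq] at hx
      have := h1 x hx.1
      rw [List.map_cons, List.mem_cons] at this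
      exact this.resolve_left hx.2) (by
      intro d hd
      rw [count_ne', h2 d (by simp [hd])]
      intro h
      exact hL.1 (h ▸ List.mem_map_of_mem hd))
    rw [length_ne' e.c w, h3, h2 e (by simp)]
    simp [tot]; omega

open scoped Classical in
noncomputable def WS : List Col → Finset (List ℤ)
  | [] => {[]}
  | e :: L => if e.a + e.t ≤ tot L then
      (WS L).biUnion fun w' => (ins e.c (mid e.a e.t w') e.s).image
        (fun m => w'.take e.a ++ m ++ w'.drop (w'.length - e.t))
      else ∅

def Mono (L : List Col) : Prop := L.Pairwise fun d e => e.a ≤ d.a ∧ e.t ≤ d.t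

theorem decomp_shrink (c : ℤ) (u m m' v : List ℤ) (a t : ℕ) (ha : a ≤ u.length)
    (ht : t ≤ v.length)
    (h : ∃ u' m'' v', u ++ m ++ v = u' ++ m'' ++ v' ∧ u'.length = a ∧ v'.length = t ∧
      c ∉ u' ∧ c ∉ v') :
    ∃ u' m'' v', u ++ m' ++ v = u' ++ m'' ++ v' ∧ u'.length = a ∧ v'.length = t ∧
      c ∉ u' ∧ c ∉ v' := by
  obtain ⟨u', m'', v', h1, h2, h3, h4, h5⟩ := h
  have e1 : u' = u.take a := by
    have := congrArg (List.take a) h1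
    rw [List.append_assoc, List.append_assoc, List.take_append_of_le_length ha, ← h2,
      List.take_left] at this
    rw [← h2, this]
  have e2 : v' = v.drop (v.length - t) := by
    have hl := congrArg List.length h1
    simp only [List.length_append] at hl
    have := congrArg (List.drop (u' ++ m'').length) h1
    rw [List.drop_left] at this
    rw [← this, List.drop_append, List.drop_eq_nil_of_le]
    · simp only [List.length_append, List.nil_append]
      congr 1; omega
    · simp only [List.length_append]; omega
  refine ⟨u.take a, u.drop a ++ m' ++ v.take (v.length - t), v.drop (v.length - t), ?_, ?_, ?_,
    e1 ▸ h4, e2 ▸ h5⟩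
  · conv_lhs => rw [← List.take_append_drop a u, ← List.take_append_drop (v.length - t) v]
    simp only [List.append_assoc]
  · simp; omega
  · simp; omega

theorem mem_WS (L : List Col) (hL : (L.map Col.c).Nodup) (hm : Mono L) : ∀ w : List ℤ,
    w ∈ WS L ↔ Good L w := by
  induction L with
  | nil =>
    intro w
    simp only [WS, Finset.mem_singleton, Good, List.map_nil, List.not_mem_nil]
    constructor
    · rintro rfl; simp
    · rintro ⟨h, _⟩
      exact List.eq_nil_iff_forall_not_mem.2 h
  | cons e L ih =>
    intro w
    rw [List.map_cons, List.nodup_cons] at hL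
    rw [Mono, List.pairwise_cons] at hm
    have ih := ih hL.2 hm.2
    have hne : ∀ d ∈ L, d.c ≠ e.c := fun d hd h => hL.1 (h ▸ List.mem_map_of_mem hd)
    rw [WS]
    constructor
    · intro h
      split_ifs at h with hat
      swap
      · simp at h
      rw [Finset.mem_biUnion] at h
      obtain ⟨w', hw', h⟩ := h
      rw [Finset.mem_image] at h
      obtain ⟨m, hmi, rfl⟩ := h
      rw [ih] at hw'
      have hlen := length_eq_tot L hL.2 w' hw'.1 (fun d hd => (hw'.2 d hd).1)
      obtain ⟨hd1, hd2, hd3⟩ := exists_decomp e.a e.t w' (by omega)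
      set u := w'.take e.a
      set v := w'.drop (w'.length - e.t)
      set m' := mid e.a e.t w'
      have hc : e.c ∉ w' := fun h => hL.1 (hw'.1 _ h)
      have hcu : e.c ∉ u := fun h => hc (by rw [hd1]; simp [h])
      have hcm : e.c ∉ m' := fun h => hc (by rw [hd1]; simp [h])
      have hcv : e.c ∉ v := fun h => hc (by rw [hd1]; simp [h])
      rw [mem_ins _ _ _ _ hcm] at hmi
      change ne' e.c m = m' ∧ _ at hmi
      have hw'' : ne' e.c (u ++ m ++ v) = w' := by
        rw [ne'_append, ne'_append, ne'_eq_self hcu, ne'_eq_self hcv, hmi.1, ← hd1]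
      refine ⟨?_, ?_⟩
      · intro x hx
        rw [List.map_cons, List.mem_cons]
        by_cases hxe : x = e.c
        · exact Or.inl hxe
        · right
          apply hw'.1
          rw [← hw'', ne', List.mem_filter]
          exact ⟨hx, by simpa using hxe⟩
      · intro d hd
        rw [List.mem_cons] at hd
        rcases hd with rfl | hd
        · refine ⟨?_, u, m, v, rfl, hd2, hd3, hcu, hcv⟩
          rw [List.count_append, List.count_append, List.count_eq_zero.2 hcu,
            List.count_eq_zero.2 hcv, hmi.2]; omega
        · have := hw'.2 d hd
          refine ⟨?_, ?_⟩
          · rw [← count_ne' (hne d hd), hw'', this.1]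
          · rw [hd1] at this
            exact decomp_shrink _ _ _ _ _ _ _ (by rw [hd2]; exact (hm.1 d hd).1)
              (by rw [hd3]; exact (hm.1 d hd).2) this.2
    · rintro ⟨h1, h2⟩
      obtain ⟨hcnt, u, m, v, rfl, hu, hv, hcu, hcv⟩ := h2 e (by simp)
      have hw'' : ne' e.c (u ++ m ++ v) = u ++ ne' e.c m ++ v := by
        rw [ne'_append, ne'_append, ne'_eq_self hcu, ne'_eq_self hcv]
      have hg : Good L (u ++ ne' e.c m ++ v) := by
        refine ⟨?_, ?_⟩
        · intro x hx
          rw [← hw'', ne', List.mem_filter] at hx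
          have := h1 x hx.1
          rw [List.map_cons, List.mem_cons] at this
          exact this.resolve_left (by simpa using hx.2)
        · intro d hd
          refine ⟨?_, ?_⟩
          · rw [← hw'', count_ne' (hne d hd)]
            exact (h2 d (by simp [hd])).1
          · exact decomp_shrink _ _ _ _ _ _ _ (by rw [hu]; exact (hm.1 d hd).1)
              (by rw [hv]; exact (hm.1 d hd).2) (h2 d (by simp [hd])).2
      have hlen := length_eq_tot L hL.2 _ hg.1 (fun d hd => (hg.2 d hd).1)
      rw [if_pos (by rw [← hlen]; simp only [List.length_append]; omega), Finset.mem_biUnion]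
      refine ⟨_, (ih _).2 hg, Finset.mem_image.2 ⟨m, ?_, ?_⟩⟩
      · rw [mid_append _ _ _ _ _ hu hv, mem_ins _ _ _ _ (not_mem_ne' _ _)]
        refine ⟨rfl, ?_⟩
        rw [← hcnt, List.count_append, List.count_append, List.count_eq_zero.2 hcu,
            List.count_eq_zero.2 hcv]; omega
      · have e1 : (u ++ ne' e.c m ++ v).take e.a = u := by
          rw [List.append_assoc, ← hu, List.take_left]
        have e2 : (u ++ ne' e.c m ++ v).drop ((u ++ ne' e.c m ++ v).length - e.t) = v := by
          have : (u ++ ne' e.c m ++ v).length - e.t = (u ++ ne' e.c m).length := by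
            simp only [List.length_append]; omega
          rw [this, List.drop_left]
        rw [e1, e2]

open LaurentPolynomial in
noncomputable def gf : List Col → LaurentPolynomial ℤ
  | [] => 1
  | e :: L => (if e.a + e.t ≤ tot L then gb (T 1) (tot L - e.a - e.t) e.s else 0) * gf L

theorem gf_congr {ι : Type*} (f g : ι → Col) (hs : ∀ i, (f i).s = (g i).s) (l : List ι)
    (hat : ∀ i ∈ l, (f i).a + (f i).t = (g i).a + (g i).t) :
    gf (l.map f) = gf (l.map g) := by
  induction l with
  | nil => rfl
  | cons i l ih =>
    have htot : tot (l.map f) = tot (l.map g) := by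
      simp only [tot, List.map_map]
      congr 1
      exact List.map_congr_left fun i _ => hs i
    have h1 := hat i (by simp)
    simp only [List.map_cons, gf, Nat.sub_sub, h1, htot, hs]
    rw [ih fun i hi => hat i (by simp [hi])]

open LaurentPolynomial in
theorem sum_WS (L : List Col) (hL : (L.map Col.c).Nodup) (hm : Mono L) :
    ∑ w ∈ WS L, (T (wmajZ L w) : LaurentPolynomial ℤ) = gf L := by
  induction L with
  | nil => simp [WS, wmajZ, gf]
  | cons e L ih =>
    have hL' := hL
    have hm' := hm
    rw [List.map_cons, List.nodup_cons] at hL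
    rw [Mono, List.pairwise_cons] at hm
    have ih := ih hL.2 hm.2
    rw [WS, gf]
    split_ifs with hat
    swap
    · simp
    have key : ∀ w' ∈ WS L, ∃ u m' v, w' = u ++ m' ++ v ∧ u.length = e.a ∧ v.length = e.t ∧
        w'.take e.a = u ∧ mid e.a e.t w' = m' ∧ w'.drop (w'.length - e.t) = v ∧
        e.c ∉ u ∧ e.c ∉ m' ∧ e.c ∉ v ∧ m'.length = tot L - e.a - e.t := by
      intro w' hw'
      rw [mem_WS L hL.2 hm.2] at hw'
      have hlen := length_eq_tot L hL.2 w' hw'.1 (fun d hd => (hw'.2 d hd).1)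
      obtain ⟨hd1, hd2, hd3⟩ := exists_decomp e.a e.t w' (by omega)
      have hc : e.c ∉ w' := fun h => hL.1 (hw'.1 _ h)
      refine ⟨_, _, _, hd1, hd2, hd3, rfl, rfl, rfl, ?_, ?_, ?_, ?_⟩
      · exact fun h => hc (by rw [hd1]; simp only [List.mem_append]; tauto)
      · exact fun h => hc (by rw [hd1]; simp only [List.mem_append]; tauto)
      · exact fun h => hc (by rw [hd1]; simp only [List.mem_append]; tauto)
      · have := congrArg List.length hd1
        rw [List.length_append, List.length_append] at this
        omega
    have hdel : ∀ w' ∈ WS L, ∀ m ∈ ins e.c (mid e.a e.t w') e.s,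
        ne' e.c (w'.take e.a ++ m ++ w'.drop (w'.length - e.t)) = w' := by
      intro w' hw' m hmm
      obtain ⟨u, m', v, h1, h2, h3, h4, h5, h6, h7, h8, h9, _⟩ := key w' hw'
      rw [h5, mem_ins _ _ _ _ h8] at hmm
      change ne' e.c m = m' ∧ _ at hmm
      rw [h4, h6, ne'_append, ne'_append, ne'_eq_self h7, ne'_eq_self h9, hmm.1, h1]
    rw [Finset.sum_biUnion, ← ih, Finset.mul_sum]
    · refine Finset.sum_congr rfl fun w' hw' => ?_
      obtain ⟨u, m', v, h1, h2, h3, h4, h5, h6, h7, h8, h9, h10⟩ := key w' hw'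
      rw [Finset.sum_image]
      · have : ∀ m ∈ ins e.c (mid e.a e.t w') e.s,
            (T (wmajZ (e :: L) (w'.take e.a ++ m ++ w'.drop (w'.length - e.t))) :
              LaurentPolynomial ℤ) = T (wmajZ L w' - wmaj m') * (T 1) ^ wmaj m := by
          intro m hmm
          rw [wmajZ, hdel w' hw' m hmm, h4, h6, mid_append _ _ _ _ _ h2 h3, T_pow, ← T_add]
          rw [h5, mem_ins _ _ _ _ h8] at hmm
          change ne' e.c m = m' ∧ _ at hmm
          rw [hmm.1]
          congr 1
          ring
        rw [Finset.sum_congr rfl this, ← Finset.mul_sum, h5, sum_ins _ _ _ h8, h10, T_pow,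
          ← mul_assoc, ← T_add, mul_comm]
        congr 2
        ring
      · intro a _ b _ hab
        simpa using hab
    · intro x hx y hy hxy
      rw [Function.onFun, Finset.disjoint_left]
      intro a ha hb
      rw [Finset.mem_image] at ha hb
      obtain ⟨m, hm1, rfl⟩ := ha
      obtain ⟨m2, hm2, h⟩ := hb
      apply hxy
      rw [← hdel x hx m hm1, ← hdel y hy m2 hm2, h]

/-! ### The major index of a rectangular filling as a word statistic -/

open scoped Classical in
theorem desR_insert (x y : Cell) (M : Finset Cell) (hyM : y ∈ M) (hx : ∀ v ∈ M, x.1 < v.1)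
    (hy : ∀ v ∈ M, v = y ∨ y.1 < v.1) :
    desR (insert x M) = desR M + if y.2 < x.2 then 1 else 0 := by
  have hxM : x ∉ M := fun h => lt_irrefl _ (hx x h)
  have hset : ((insert x M ×ˢ insert x M).filter fun p : Cell × Cell =>
      p.1.1 < p.2.1 ∧ p.2.2 < p.1.2 ∧ ∀ z ∈ insert x M, ¬ (p.1.1 < z.1 ∧ z.1 < p.2.1)) =
      ((M ×ˢ M).filter fun p : Cell × Cell =>
      p.1.1 < p.2.1 ∧ p.2.2 < p.1.2 ∧ ∀ z ∈ M, ¬ (p.1.1 < z.1 ∧ z.1 < p.2.1)) ∪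
      (if y.2 < x.2 then {(x, y)} else ∅) := by
    ext ⟨a, b⟩
    simp only [Finset.mem_union, Finset.mem_filter, Finset.mem_product, Finset.mem_insert]
    constructor
    · rintro ⟨⟨ha, hb⟩, h1, h2, h3⟩
      rcases ha with rfl | ha
      · rcases hb with rfl | hb
        · exact absurd h1 (lt_irrefl _)
        · right
          have : b = y := by
            rcases hy b hb with h | h
            · exact h
            · exact absurd ⟨hx y hyM, h⟩ (h3 y (Or.inr hyM))
          subst this
          simp [h2]
      · rcases hb with rfl | hb
        · exact absurd (hx a ha) (not_lt.2 h1.le)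
        · left
          exact ⟨⟨ha, hb⟩, h1, h2, fun z hz => h3 z (Or.inr hz)⟩
    · rintro (⟨⟨ha, hb⟩, h1, h2, h3⟩ | h)
      · refine ⟨⟨Or.inr ha, Or.inr hb⟩, h1, h2, ?_⟩
        rintro z (rfl | hz)
        · rintro ⟨h4, h5⟩
          exact absurd (hx a ha) (not_lt.2 h4.le)
        · exact h3 z hz
      · split_ifs at h with hc
        · simp only [Finset.mem_singleton, Prod.mk.injEq] at h
          obtain ⟨rfl, rfl⟩ := h
          refine ⟨⟨Or.inl rfl, Or.inr hyM⟩, hx _ hyM, hc, ?_⟩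
          rintro z (rfl | hz)
          · simp
          · rintro ⟨h4, h5⟩
            rcases hy z hz with rfl | h
            · exact lt_irrefl _ h5
            · exact lt_asymm h h5
        · simp at h
  rw [desR, desR, hset, Finset.card_union_of_disjoint]
  · split_ifs <;> simp
  · rw [Finset.disjoint_left]
    rintro ⟨a, b⟩ ha hb
    split_ifs at hb with hc
    · simp only [Finset.mem_singleton, Prod.mk.injEq] at hb
      obtain ⟨rfl, rfl⟩ := hb
      simp only [Finset.mem_filter, Finset.mem_product] at ha
      exact hxM ha.1.1
    · simp at hb

theorem desR_singleton (x : Cell) : desR {x} = 0 := by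
  classical
  rw [desR, Finset.card_eq_zero, Finset.filter_eq_empty_iff]
  rintro ⟨a, b⟩ h
  simp only [Finset.mem_product, Finset.mem_singleton] at h
  obtain ⟨rfl, rfl⟩ := h
  simp

def RowSorted (z : List Cell) : Prop := z.Pairwise fun x y => x.1 < y.1

theorem majR_toFinset (z : List Cell) (hz : RowSorted z) :
    majR z.toFinset = wmaj (z.map Prod.snd) := by
  induction z with
  | nil => simp [majR, wmaj]
  | cons x z ih =>
    rw [RowSorted, List.pairwise_cons] at hz
    have ih := ih hz.2
    cases z with
    | nil =>
      simp [majR, wmaj, Finset.filter_singleton, desR_singleton]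
    | cons y l =>
      have hz2 := hz.2
      rw [List.pairwise_cons] at hz2
      set M := (y :: l).toFinset with hM
      have hx : ∀ v ∈ M, x.1 < v.1 := fun v hv => hz.1 v (by simpa [hM] using hv)
      have hxM : x ∉ M := fun h => lt_irrefl _ (hx x h)
      have hy : ∀ v ∈ M, v = y ∨ y.1 < v.1 := by
        intro v hv
        have : v = y ∨ v ∈ l := by simpa [hM] using hv
        exact this.imp_right (hz2.1 v)
      have hyM : y ∈ M := by simp [hM]
      have hcard : M.card = l.length + 1 := by
        rw [hM, List.toFinset_card_of_nodup]
        · rfl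
        · exact hz.2.imp fun {a b} h hab => by rw [hab] at h; exact lt_irrefl _ h
      rw [List.toFinset_cons, ← hM, List.map_cons, List.map_cons, wmaj_cons_cons,
        ← List.map_cons, ← ih, majR, Finset.sum_insert hxM]
      have h0 : (insert x M).filter (fun v => v.1 ≤ x.1) = {x} := by
        ext v
        simp only [Finset.mem_filter, Finset.mem_insert, Finset.mem_singleton]
        constructor
        · rintro ⟨h | h, h'⟩
          · exact h
          · exact absurd (hx v h) (not_lt.2 h')
        · rintro rfl; simp
      have h1 : ∀ v ∈ M, desR ((insert x M).filter (fun u => u.1 ≤ v.1)) =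
          desR (M.filter (fun u => u.1 ≤ v.1)) + if y.2 < x.2 then 1 else 0 := by
        intro v hv
        rw [Finset.filter_insert, if_pos (hx v hv).le]
        apply desR_insert
        · rw [Finset.mem_filter]
          refine ⟨hyM, ?_⟩
          rcases hy v hv with h | h
          · rw [h]
          · exact h.le
        · exact fun u hu => hx u (Finset.mem_filter.1 hu).1
        · exact fun u hu => hy u (Finset.mem_filter.1 hu).1
      rw [h0, desR_singleton, Finset.sum_congr rfl h1, Finset.sum_add_distrib, zero_add,
        Finset.sum_const, hcard, ← majR]
      simp

theorem exists_list (M : Finset Cell) (hM : ∀ x ∈ M, ∀ y ∈ M, x.1 = y.1 → x = y) :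
    ∃ z : List Cell, RowSorted z ∧ z.toFinset = M := by
  induction hn : M.card generalizing M with
  | zero => exact ⟨[], List.Pairwise.nil, by rw [Finset.card_eq_zero.1 hn]; rfl⟩
  | succ n ih =>
    have hne : M.Nonempty := Finset.card_pos.1 (by omega)
    obtain ⟨x, hx, hmin⟩ := M.exists_min_image Prod.fst hne
    obtain ⟨z, hz, hzM⟩ := ih (M.erase x)
      (fun a ha b hb => hM a (Finset.mem_of_mem_erase ha) b (Finset.mem_of_mem_erase hb))
      (by rw [Finset.card_erase_of_mem hx]; omega)
    refine ⟨x :: z, ?_, ?_⟩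
    · rw [RowSorted, List.pairwise_cons]
      refine ⟨fun a ha => ?_, hz⟩
      have ha' : a ∈ M.erase x := by rw [← hzM]; simpa using ha
      rw [Finset.mem_erase] at ha'
      refine lt_of_le_of_ne (hmin a ha'.2) fun h => ha'.1 (hM x hx a ha'.2 h).symm
    · rw [List.toFinset_cons, hzM, Finset.insert_erase hx]

theorem RowSorted.filter {z : List Cell} (hz : RowSorted z) (p : Cell → Bool) :
    RowSorted (z.filter p) := List.Pairwise.sublist List.filter_sublist hz

theorem majR_filter (z : List Cell) (hz : RowSorted z) (p : Cell → Prop) [DecidablePred p] :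
    majR (z.toFinset.filter p) = wmaj ((z.filter (fun x => decide (p x))).map Prod.snd) := by
  rw [← majR_toFinset _ (hz.filter _)]
  congr 1
  ext x; simp

theorem majR_filter_le (M : Finset Cell) (hM : ∀ x ∈ M, ∀ y ∈ M, x.1 = y.1 → x = y)
    (p : Cell → Prop) [DecidablePred p] : majR (M.filter p) ≤ majR M := by
  obtain ⟨z, hz, rfl⟩ := exists_list M hM
  rw [majR_filter z hz, majR_toFinset z hz]
  exact wmaj_sublist (List.Sublist.map _ List.filter_sublist)

/-! ### Geometry of moon polyominoes -/

def colRows (P : Finset Cell) (c : ℤ) : Finset ℤ := (P.filter fun x => x.2 = c).image Prod.fst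

theorem mem_colRows {P : Finset Cell} {c r : ℤ} : r ∈ colRows P c ↔ (r, c) ∈ P := by
  simp [colRows]

theorem card_colRows (P : Finset Cell) (c : ℤ) : (colRows P c).card = colLen P c := by
  rw [colRows, colLen, Finset.card_image_of_injOn]
  rintro ⟨a, b⟩ hx ⟨a', b'⟩ hy h
  simp at hx hy h
  ext <;> simp [h, hx.2, hy.2]

theorem mem_colSet {P : Finset Cell} {c : ℤ} : c ∈ colSet P ↔ ∃ r, (r, c) ∈ P := by
  simp [colSet]

theorem mem_rowSet {P : Finset Cell} {r : ℤ} : r ∈ rowSet P ↔ ∃ c, (r, c) ∈ P := by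
  simp [rowSet]

theorem IsMoon.sub {P : Finset Cell} (hP : IsMoon P) {c d r : ℤ} (h : colLen P c ≤ colLen P d)
    (hr : (r, c) ∈ P) : (r, d) ∈ P := by
  rcases hP.2.2 c d with h1 | h1
  · exact h1 r hr
  · have hs : colRows P d ⊆ colRows P c := fun r hr => mem_colRows.2 (h1 r (mem_colRows.1 hr))
    have := Finset.eq_of_subset_of_card_le hs (by rw [card_colRows, card_colRows]; exact h)
    rw [← mem_colRows, this, mem_colRows]; exact hr

theorem colLen_le_of_sub {P : Finset Cell} {c d : ℤ} (h : ∀ r, (r, c) ∈ P → (r, d) ∈ P) :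
    colLen P c ≤ colLen P d := by
  rw [← card_colRows, ← card_colRows]
  exact Finset.card_le_card fun r hr => mem_colRows.2 (h r (mem_colRows.1 hr))

def InI (P : Finset Cell) (l : ℕ) (r : ℤ) : Prop := ∃ d ∈ colSet P, colLen P d = l ∧ (r, d) ∈ P

theorem InI_colLen {P : Finset Cell} (hP : IsMoon P) {c : ℤ} (r : ℤ) :
    InI P (colLen P c) r ↔ (r, c) ∈ P := by
  constructor
  · rintro ⟨d, hd, h1, h2⟩
    exact hP.sub h1.le h2
  · intro h
    exact ⟨c, mem_colSet.2 ⟨r, h⟩, rfl, h⟩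

open scoped Classical in
noncomputable def RL (P : Finset Cell) (l : ℕ) : Finset Cell :=
  P.filter fun x => InI P l x.1 ∧ l ≤ colLen P x.2

theorem mem_RL {P : Finset Cell} {l : ℕ} {x : Cell} :
    x ∈ RL P l ↔ x ∈ P ∧ InI P l x.1 ∧ l ≤ colLen P x.2 := by
  simp [RL]

theorem mem_RL' {P : Finset Cell} (hP : IsMoon P) {c : ℤ} {x : Cell} :
    x ∈ RL P (colLen P c) ↔ (x.1, c) ∈ P ∧ colLen P c ≤ colLen P x.2 := by
  rw [mem_RL, InI_colLen hP]
  constructor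
  · exact fun h => h.2
  · exact fun h => ⟨hP.sub h.2 h.1, h⟩

def lens (P : Finset Cell) : Finset ℕ := (colSet P).image (colLen P)

theorem nRows_RL {P : Finset Cell} (hP : IsMoon P) {l : ℕ} (hl : l ∈ lens P) :
    nRows (RL P l) = l := by
  rw [lens, Finset.mem_image] at hl
  obtain ⟨c, hc, rfl⟩ := hl
  rw [nRows]
  conv_rhs => rw [← card_colRows]
  congr 1
  ext r
  rw [Finset.mem_image, mem_colRows]
  constructor
  · rintro ⟨x, hx, rfl⟩
    exact ((mem_RL' hP).1 hx).1
  · intro h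
    exact ⟨(r, c), (mem_RL' hP).2 ⟨h, le_rfl⟩, rfl⟩

theorem isRect_RL {P : Finset Cell} (hP : IsMoon P) {c : ℤ} (hc : c ∈ colSet P) :
    IsRect (RL P (colLen P c)) := by
  have h1 : (colRows P c).Nonempty := by
    obtain ⟨r, hr⟩ := mem_colSet.1 hc
    exact ⟨r, mem_colRows.2 hr⟩
  set D := (colSet P).filter fun d => colLen P c ≤ colLen P d with hD
  have h2 : D.Nonempty := ⟨c, by simp [hD, hc]⟩
  refine ⟨(colRows P c).min' h1, (colRows P c).max' h1, D.min' h2, D.max' h2,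
    Finset.min'_le_max' _ _, Finset.min'_le_max' _ _, ?_⟩
  have a1 := mem_colRows.1 ((colRows P c).min'_mem h1)
  have a2 := mem_colRows.1 ((colRows P c).max'_mem h1)
  have a3 := Finset.mem_filter.1 (D.min'_mem h2)
  have a4 := Finset.mem_filter.1 (D.max'_mem h2)
  ext ⟨r, d⟩
  rw [mem_RL' hP, Finset.mem_product, Finset.mem_Icc, Finset.mem_Icc]
  constructor
  · rintro ⟨h3, h4⟩
    have hr := mem_colRows.2 h3
    have hd : d ∈ D := Finset.mem_filter.2 ⟨mem_colSet.2 ⟨r, hP.sub h4 h3⟩, h4⟩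
    exact ⟨⟨Finset.min'_le _ _ hr, Finset.le_max' _ _ hr⟩,
      ⟨Finset.min'_le _ _ hd, Finset.le_max' _ _ hd⟩⟩
  · rintro ⟨⟨h3, h4⟩, ⟨h5, h6⟩⟩
    refine ⟨hP.2.1 c _ _ r a1 a2 h3 h4, ?_⟩
    apply colLen_le_of_sub
    intro r' hr'
    exact hP.1 r' _ _ d (hP.sub a3.2 hr') (hP.sub a4.2 hr') h5 h6

open scoped Classical in
theorem maxRects_eq {P : Finset Cell} (hP : IsMoon P) : maxRects P = (lens P).image (RL P) := by
  ext R
  rw [maxRects, Finset.mem_filter, Finset.mem_powerset, Finset.mem_image]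
  constructor
  · rintro ⟨hRP, ⟨r₁, r₂, c₁, c₂, hr, hc, rfl⟩, -, hmax⟩
    obtain ⟨c, hcm, hmin⟩ := (Finset.Icc c₁ c₂).exists_min_image (colLen P)
      (Finset.nonempty_Icc.2 hc)
    have hsub : ∀ r ∈ Finset.Icc r₁ r₂, ∀ d ∈ Finset.Icc c₁ c₂, (r, d) ∈ P :=
      fun r hr d hd => hRP (Finset.mem_product.2 ⟨hr, hd⟩)
    have hcP : c ∈ colSet P := mem_colSet.2 ⟨r₁, hsub _ (by simp [hr]) _ hcm⟩
    refine ⟨colLen P c, Finset.mem_image_of_mem _ hcP, ?_⟩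
    apply hmax
    · exact isRect_RL hP hcP
    · exact fun x hx => (mem_RL.1 hx).1
    · rintro ⟨r, d⟩ hx
      rw [Finset.mem_product] at hx
      rw [mem_RL' hP]
      exact ⟨hsub _ hx.1 _ hcm, hmin _ hx.2⟩
  · rintro ⟨l, hl, rfl⟩
    rw [lens, Finset.mem_image] at hl
    obtain ⟨c, hc, rfl⟩ := hl
    have hs : RL P (colLen P c) ⊆ P := fun x hx => (mem_RL.1 hx).1
    refine ⟨hs, isRect_RL hP hc, hs, ?_⟩
    rintro R' ⟨r₁, r₂, c₁, c₂, hr, hc', rfl⟩ hR'P hRR'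
    refine Finset.Subset.antisymm ?_ hRR'
    have hI : ∀ r, (r, c) ∈ P → r ∈ Finset.Icc r₁ r₂ ∧ c ∈ Finset.Icc c₁ c₂ := by
      intro r hr
      have := hRR' ((mem_RL' hP (x := (r, c))).2 ⟨hr, le_rfl⟩)
      rwa [Finset.mem_product] at this
    rintro ⟨r, d⟩ hx
    rw [Finset.mem_product] at hx
    rw [mem_RL' hP]
    obtain ⟨r₀, hr₀⟩ := mem_colSet.1 hc
    refine ⟨hR'P (Finset.mem_product.2 ⟨hx.1, (hI r₀ hr₀).2⟩), ?_⟩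
    apply colLen_le_of_sub
    intro r' hr'
    exact hR'P (Finset.mem_product.2 ⟨(hI r' hr').1, hx.2⟩)

theorem RL_injOn {P : Finset Cell} (hP : IsMoon P) : Set.InjOn (RL P) (lens P) := by
  intro a ha b hb h
  rw [← nRows_RL hP ha, ← nRows_RL hP hb, h]

theorem majR_empty : majR ∅ = 0 := by simp [majR]

open scoped Classical in
theorem majP_eq {P M : Finset Cell} (hP : IsMoon P) (hMP : M ⊆ P)
    (hM : ∀ x ∈ M, ∀ y ∈ M, x.1 = y.1 → x = y) :
    (majP P M : ℤ) = ∑ l ∈ lens P,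
      ((majR (M.filter fun x => InI P l x.1 ∧ l ≤ colLen P x.2) : ℤ) -
        majR (M.filter fun x => InI P l x.1 ∧ l < colLen P x.2)) := by
  have e1 : ∑ R ∈ maxRects P, majR (M ∩ R) = ∑ l ∈ lens P,
      majR (M.filter fun x => InI P l x.1 ∧ l ≤ colLen P x.2) := by
    rw [maxRects_eq hP, Finset.sum_image (RL_injOn hP)]
    refine Finset.sum_congr rfl fun l _ => ?_
    congr 1
    ext x
    rw [Finset.mem_inter, mem_RL, Finset.mem_filter]
    constructor
    · exact fun h => ⟨h.1, h.2.2⟩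
    · exact fun h => ⟨h.1, hMP h.1, h.2⟩
  have e2 : ∑ p ∈ (maxRects P ×ˢ maxRects P).filter
        (fun p => nRows p.1 < nRows p.2 ∧
          ∀ T ∈ maxRects P, ¬ (nRows p.1 < nRows T ∧ nRows T < nRows p.2)),
      majR (M ∩ p.1 ∩ p.2) = ∑ l ∈ lens P,
      majR (M.filter fun x => InI P l x.1 ∧ l < colLen P x.2) := by
    rw [Finset.sum_filter, Finset.sum_product, maxRects_eq hP, Finset.sum_image (RL_injOn hP)]
    refine Finset.sum_congr rfl fun l hl => ?_
    rw [Finset.sum_image (RL_injOn hP)]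
    have hcond : ∀ l' ∈ lens P, ((nRows (RL P l) < nRows (RL P l') ∧
        ∀ T ∈ (lens P).image (RL P), ¬ (nRows (RL P l) < nRows T ∧ nRows T < nRows (RL P l'))) ↔
        (l < l' ∧ ∀ k ∈ lens P, ¬ (l < k ∧ k < l'))) := by
      intro l' hl'
      rw [nRows_RL hP hl, nRows_RL hP hl']
      refine and_congr_right fun _ => ?_
      constructor
      · intro h k hk
        have := h _ (Finset.mem_image_of_mem _ hk)
        rwa [nRows_RL hP hk] at this
      · intro h T hT
        obtain ⟨k, hk, rfl⟩ := Finset.mem_image.1 hT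
        rw [nRows_RL hP hk]
        exact h k hk
    dsimp only
    rw [Finset.sum_congr rfl fun l' hl' => if_congr (hcond l' hl') rfl rfl]
    by_cases hne : ((lens P).filter fun k => l < k).Nonempty
    · obtain ⟨l', hl', hmin⟩ := Finset.exists_min_image _ id hne
      rw [Finset.mem_filter] at hl'
      rw [Finset.sum_eq_single l', if_pos]
      · congr 1
        ext x
        rw [Finset.mem_inter, Finset.mem_inter, mem_RL, mem_RL, Finset.mem_filter]
        constructor
        · rintro ⟨⟨h1, _, h2, _⟩, _, _, h3⟩
          exact ⟨h1, h2, lt_of_lt_of_le hl'.2 h3⟩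
        · rintro ⟨h1, h2, h3⟩
          refine ⟨⟨h1, hMP h1, h2, h3.le⟩, hMP h1, ?_, ?_⟩
          · obtain ⟨c, hc, hcl⟩ := Finset.mem_image.1 hl'.1
            rw [← hcl, InI_colLen hP]
            obtain ⟨d, hd, hdl⟩ := Finset.mem_image.1 hl
            rw [← hdl, InI_colLen hP] at h2
            refine hP.sub ?_ h2
            rw [hcl, hdl]; exact hl'.2.le
          · refine hmin _ (Finset.mem_filter.2 ⟨Finset.mem_image_of_mem _ ?_, h3⟩)
            exact mem_colSet.2 ⟨x.1, hMP h1⟩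
      · refine ⟨hl'.2, fun k hk hh => ?_⟩
        have := hmin k (Finset.mem_filter.2 ⟨hk, hh.1⟩)
        simp only [id] at this
        omega
      · intro b hb hbl
        rw [if_neg]
        rintro ⟨h1, h2⟩
        have h3 := hmin b (Finset.mem_filter.2 ⟨hb, h1⟩)
        simp only [id] at h3
        exact h2 l' hl'.1 ⟨hl'.2, by omega⟩
      · exact fun h => absurd hl'.1 h
    · rw [Finset.not_nonempty_iff_eq_empty, Finset.filter_eq_empty_iff] at hne
      rw [Finset.sum_eq_zero]
      · rw [Finset.filter_eq_empty_iff.2, majR_empty]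
        intro x hx hh
        exact hne (Finset.mem_image_of_mem _ (mem_colSet.2 ⟨x.1, hMP hx⟩)) hh.2
      · intro l' hl'
        rw [if_neg]
        exact fun h => hne hl' h.1
  rw [majP, e1, e2, Finset.sum_sub_distrib, Nat.cast_sub, Nat.cast_sum, Nat.cast_sum]
  refine Finset.sum_le_sum fun l _ => ?_
  have : (M.filter fun x => InI P l x.1 ∧ l < colLen P x.2) =
      (M.filter fun x => InI P l x.1 ∧ l ≤ colLen P x.2).filter fun x => l < colLen P x.2 := by
    ext x
    simp only [Finset.mem_filter]
    constructor
    · exact fun h => ⟨⟨h.1, h.2.1, h.2.2.le⟩, h.2.2⟩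
    · exact fun h => ⟨h.1.1, h.1.2.1, h.2⟩
  rw [this]
  apply majR_filter_le
  intro x hx y hy
  exact hM x (Finset.mem_filter.1 hx).1 y (Finset.mem_filter.1 hy).1

open scoped Classical in
noncomputable def tele (P M : Finset Cell) : List ℤ → ℤ
  | [] => 0
  | c :: L => tele P M L + ((majR (M.filter fun x => (x.1, c) ∈ P ∧ x.2 ∈ c :: L) : ℤ) -
      majR (M.filter fun x => (x.1, c) ∈ P ∧ x.2 ∈ L))

open scoped Classical in
theorem tele_eq {P M : Finset Cell} (hP : IsMoon P) (L : List ℤ)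
    (hs : L.Pairwise fun c d => colLen P c ≤ colLen P d) (hL : ∀ c ∈ L, c ∈ colSet P) :
    tele P M L = ∑ l ∈ lens P,
      ((majR (M.filter fun x => InI P l x.1 ∧ l ≤ colLen P x.2 ∧ x.2 ∈ L) : ℤ) -
        majR (M.filter fun x => InI P l x.1 ∧ l < colLen P x.2 ∧ x.2 ∈ L)) := by
  induction L with
  | nil => simp [tele]
  | cons c L ih =>
    rw [List.pairwise_cons] at hs
    rw [tele, ih hs.2 fun d hd => hL d (by simp [hd]), eq_comm, ← sub_eq_iff_eq_add',
      ← Finset.sum_sub_distrib]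
    have hc : colLen P c ∈ lens P := Finset.mem_image_of_mem _ (hL c (by simp))
    have hge : ∀ d ∈ c :: L, colLen P c ≤ colLen P d := by
      intro d hd
      rcases List.mem_cons.1 hd with rfl | h
      · exact le_rfl
      · exact hs.1 d h
    rw [Finset.sum_eq_single (colLen P c)]
    · have a1 : (M.filter fun x => InI P (colLen P c) x.1 ∧ colLen P c ≤ colLen P x.2 ∧
          x.2 ∈ c :: L) = M.filter fun x => (x.1, c) ∈ P ∧ x.2 ∈ c :: L := by
        refine Finset.filter_congr fun x _ => ?_
        rw [InI_colLen hP]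
        exact ⟨fun h => ⟨h.1, h.2.2⟩, fun h => ⟨h.1, hge _ h.2, h.2⟩⟩
      have a2 : (M.filter fun x => InI P (colLen P c) x.1 ∧ colLen P c ≤ colLen P x.2 ∧
          x.2 ∈ L) = M.filter fun x => (x.1, c) ∈ P ∧ x.2 ∈ L := by
        refine Finset.filter_congr fun x _ => ?_
        rw [InI_colLen hP]
        exact ⟨fun h => ⟨h.1, h.2.2⟩, fun h => ⟨h.1, hs.1 _ h.2, h.2⟩⟩
      have a3 : (M.filter fun x => InI P (colLen P c) x.1 ∧ colLen P c < colLen P x.2 ∧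
          x.2 ∈ c :: L) = M.filter fun x => InI P (colLen P c) x.1 ∧
          colLen P c < colLen P x.2 ∧ x.2 ∈ L := by
        refine Finset.filter_congr fun x _ => ?_
        refine and_congr_right fun _ => and_congr_right fun h => ?_
        rw [List.mem_cons, or_iff_right]
        intro h'
        rw [h'] at h
        exact lt_irrefl _ h
      rw [a1, a2, a3]
      ring
    · intro l _ hl
      rcases lt_or_gt_of_ne hl with h | h
      · have a1 : ∀ L' : List ℤ, (∀ d ∈ L', d ∈ c :: L) →
            (M.filter fun x => InI P l x.1 ∧ l ≤ colLen P x.2 ∧ x.2 ∈ L') =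
            M.filter fun x => InI P l x.1 ∧ l < colLen P x.2 ∧ x.2 ∈ L' := by
          intro L' hL'
          refine Finset.filter_congr fun x _ => ?_
          refine and_congr_right fun _ => ?_
          exact ⟨fun h' => ⟨lt_of_lt_of_le h (hge _ (hL' _ h'.2)), h'.2⟩,
            fun h' => ⟨h'.1.le, h'.2⟩⟩
        rw [a1 L fun d hd => by simp [hd], a1 (c :: L) fun d hd => hd]
        ring
      · have a1 : (M.filter fun x => InI P l x.1 ∧ l ≤ colLen P x.2 ∧ x.2 ∈ c :: L) =
            M.filter fun x => InI P l x.1 ∧ l ≤ colLen P x.2 ∧ x.2 ∈ L := by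
          refine Finset.filter_congr fun x _ => ?_
          refine and_congr_right fun _ => and_congr_right fun h1 => ?_
          rw [List.mem_cons, or_iff_right]
          intro h'
          rw [h'] at h1
          omega
        have a2 : (M.filter fun x => InI P l x.1 ∧ l < colLen P x.2 ∧ x.2 ∈ c :: L) =
            M.filter fun x => InI P l x.1 ∧ l < colLen P x.2 ∧ x.2 ∈ L := by
          refine Finset.filter_congr fun x _ => ?_
          refine and_congr_right fun _ => and_congr_right fun h1 => ?_
          rw [List.mem_cons, or_iff_right]
          intro h'
          rw [h'] at h1
          omega
        rw [a1, a2]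
        ring
    · exact fun h => absurd hc h

theorem majP_eq_tele {P M : Finset Cell} (hP : IsMoon P) (hMP : M ⊆ P)
    (hM : ∀ x ∈ M, ∀ y ∈ M, x.1 = y.1 → x = y) (L : List ℤ)
    (hs : L.Pairwise fun c d => colLen P c ≤ colLen P d) (hL : ∀ c, c ∈ L ↔ c ∈ colSet P) :
    (majP P M : ℤ) = tele P M L := by
  classical
  rw [tele_eq hP L hs fun c hc => (hL c).1 hc, majP_eq hP hMP hM]
  have hx : ∀ x ∈ M, x.2 ∈ L := fun x hx => (hL _).2 (mem_colSet.2 ⟨x.1, hMP hx⟩)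
  refine Finset.sum_congr rfl fun l _ => ?_
  congr 3
  · refine Finset.filter_congr fun x h => ?_
    simp [hx x h]
  · refine Finset.filter_congr fun x h => ?_
    simp [hx x h]

/-! ### From fillings to words -/

theorem split3 {α : Type*} (k : α → ℕ) (l : List α) (h : l.Pairwise fun x y => k x ≤ k y)
    (h2 : ∀ x ∈ l, k x ≤ 2) :
    l = l.filter (fun x => decide (k x = 0)) ++ l.filter (fun x => decide (k x = 1)) ++
      l.filter (fun x => decide (k x = 2)) := by
  induction l with
  | nil => rfl
  | cons x l ih =>
    rw [List.pairwise_cons] at h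
    have ih := ih h.2 fun y hy => h2 y (by simp [hy])
    have hx := h2 x (by simp)
    have h012 : k x = 0 ∨ k x = 1 ∨ k x = 2 := by omega
    rcases h012 with h0 | h0 | h0
    · simp only [List.filter_cons, h0]
      simpa using ih
    · have e : l.filter (fun x => decide (k x = 0)) = [] := by
        rw [List.filter_eq_nil_iff]
        intro y hy
        have := h.1 y hy
        simp; omega
      simp only [List.filter_cons, h0]
      rw [e] at ih ⊢
      simpa using ih
    · have e : l.filter (fun x => decide (k x = 0)) = [] := by
        rw [List.filter_eq_nil_iff]
        intro y hy
        have := h.1 y hy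
        simp; omega
      have e' : l.filter (fun x => decide (k x = 1)) = [] := by
        rw [List.filter_eq_nil_iff]
        intro y hy
        have := h.1 y hy
        simp; omega
      simp only [List.filter_cons, h0]
      rw [e, e'] at ih ⊢
      simpa using ih

open scoped Classical in
/-- position of row `r` with respect to column `c`: above, inside, below -/
noncomputable def kk (P : Finset Cell) (c r : ℤ) : ℕ :=
  if (r, c) ∈ P then 1 else if ∃ r', r < r' ∧ (r', c) ∈ P then 0 else 2

theorem kk_eq_one {P : Finset Cell} {c r : ℤ} : kk P c r = 1 ↔ (r, c) ∈ P := by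
  rw [kk]; split_ifs <;> simp_all

theorem kk_eq_zero {P : Finset Cell} {c r : ℤ} :
    kk P c r = 0 ↔ (r, c) ∉ P ∧ ∃ r', r < r' ∧ (r', c) ∈ P := by
  rw [kk]; split_ifs <;> simp_all

theorem kk_eq_two {P : Finset Cell} {c r : ℤ} :
    kk P c r = 2 ↔ (r, c) ∉ P ∧ ¬ ∃ r', r < r' ∧ (r', c) ∈ P := by
  rw [kk]; split_ifs <;> simp_all

theorem kk_le (P : Finset Cell) (c r : ℤ) : kk P c r ≤ 2 := by
  rw [kk]; split_ifs <;> simp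

theorem kk_mono {P : Finset Cell} (hP : IsMoon P) (c : ℤ) {r r' : ℤ} (h : r < r') :
    kk P c r ≤ kk P c r' := by
  have h1 := kk_le P c r
  have h2 := kk_le P c r'
  by_contra! hlt
  have hcase : kk P c r' = 0 ∨ kk P c r' = 1 := by omega
  rcases hcase with h0 | h0
  · obtain ⟨ha, r₂, hr₂, hb⟩ := kk_eq_zero.1 h0
    by_cases hin : (r, c) ∈ P
    · exact ha (hP.2.1 c r r₂ r' hin hb h.le hr₂.le)
    · have : kk P c r = 0 := kk_eq_zero.2 ⟨hin, r₂, h.trans hr₂, hb⟩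
      omega
  · have h3 : kk P c r = 2 := by omega
    exact (kk_eq_two.1 h3).2 ⟨r', h, kk_eq_one.1 h0⟩

theorem split_rows {P : Finset Cell} (hP : IsMoon P) (c : ℤ) (l : List ℤ)
    (h : l.Pairwise fun x y => x < y) :
    l = l.filter (fun x => decide (kk P c x = 0)) ++ l.filter (fun x => decide (kk P c x = 1)) ++
      l.filter (fun x => decide (kk P c x = 2)) :=
  split3 _ _ (h.imp fun {_ _} h => kk_mono hP c h) fun _ _ => kk_le _ _ _

theorem split_cells {P : Finset Cell} (hP : IsMoon P) (c : ℤ) (l : List Cell)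
    (h : RowSorted l) :
    l = l.filter (fun x => decide (kk P c x.1 = 0)) ++
      l.filter (fun x => decide (kk P c x.1 = 1)) ++
      l.filter (fun x => decide (kk P c x.1 = 2)) :=
  split3 (fun x : Cell => kk P c x.1) _ (h.imp fun {_ _} h => kk_mono hP c h) fun _ _ => kk_le _ _ _

noncomputable def mkCol (P : Finset Cell) (ρ : List ℤ) (s : ℤ → ℕ) (c : ℤ) : Col where
  c := c
  s := s c
  a := ρ.countP fun r => decide (kk P c r = 0)
  t := ρ.countP fun r => decide (kk P c r = 2)

theorem tele_wmajZ {P : Finset Cell} (hP : IsMoon P) (z : List Cell) (hz : RowSorted z)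
    (ρ : List ℤ) (s : ℤ → ℕ) (hzP : ∀ x ∈ z, x ∈ P) (L : List ℤ) (hL : L.Nodup)
    (hs : L.Pairwise fun c d => colLen P c ≤ colLen P d)
    (ha : ∀ c ∈ L, (z.filter (fun x => decide (x.2 ∈ L))).countP
      (fun x => decide (kk P c x.1 = 0)) = ρ.countP fun r => decide (kk P c r = 0))
    (ht : ∀ c ∈ L, (z.filter (fun x => decide (x.2 ∈ L))).countP
      (fun x => decide (kk P c x.1 = 2)) = ρ.countP fun r => decide (kk P c r = 2)) :
    tele P z.toFinset L =
      wmajZ (L.map (mkCol P ρ s)) ((z.filter (fun x => decide (x.2 ∈ L))).map Prod.snd) := by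
  induction L with
  | nil => simp [tele, wmajZ]
  | cons c L ih =>
    rw [List.nodup_cons] at hL
    rw [List.pairwise_cons] at hs
    have hdel : z.filter (fun x => decide (x.2 ∈ L)) =
        (z.filter (fun x => decide (x.2 ∈ c :: L))).filter (fun x => decide (x.2 ≠ c)) := by
      rw [List.filter_filter]
      refine List.filter_congr fun x _ => ?_
      rw [← Bool.decide_and, decide_eq_decide]
      constructor
      · intro h
        exact ⟨fun h' => hL.1 (h' ▸ h), by simp [h]⟩
      · rintro ⟨h1, h2⟩
        exact (List.mem_cons.1 h2).resolve_left h1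
    have hcount : ∀ d ∈ L, ∀ i, i ≠ 1 → (z.filter (fun x => decide (x.2 ∈ L))).countP
        (fun x => decide (kk P d x.1 = i)) = (z.filter (fun x => decide (x.2 ∈ c :: L))).countP
        (fun x => decide (kk P d x.1 = i)) := by
      intro d hd i hi
      rw [hdel, List.countP_filter]
      refine List.countP_congr fun x hx => ?_
      rw [← Bool.decide_and, decide_eq_true_eq, decide_eq_true_eq, and_iff_left_iff_imp]
      intro h1 h2
      have hxP := hzP x (List.mem_filter.1 hx).1
      have : kk P d x.1 = 1 := kk_eq_one.2 (hP.sub (hs.1 d hd) (by rw [← h2]; exact hxP))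
      omega
    have ih := ih hL.2 hs.2
      (fun d hd => by rw [hcount d hd 0 (by omega)]; exact ha d (by simp [hd]))
      (fun d hd => by rw [hcount d hd 2 (by omega)]; exact ht d (by simp [hd]))
    set zc := z.filter (fun x => decide (x.2 ∈ c :: L)) with hzc
    have hsplit := split_cells hP c zc (hz.filter _)
    have hmid : mid (mkCol P ρ s c).a (mkCol P ρ s c).t (zc.map Prod.snd) =
        (zc.filter (fun x => decide (kk P c x.1 = 1))).map Prod.snd := by
      conv_lhs => rw [hsplit]
      rw [List.map_append, List.map_append]
      apply mid_append
      · rw [List.length_map, ← List.countP_eq_length_filter]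
        exact ha c (by simp)
      · rw [List.length_map, ← List.countP_eq_length_filter]
        exact ht c (by simp)
    have hne : ∀ l : List Cell, ne' c (l.map Prod.snd) =
        (l.filter (fun x => decide (x.2 ≠ c))).map Prod.snd := by
      intro l
      rw [ne', List.filter_map]
      rfl
    rw [tele, List.map_cons, wmajZ, hmid]
    change _ = wmajZ _ (ne' c _) + _ - (wmaj (ne' c _) : ℤ)
    rw [hne, hne, ← hdel, ih, majR_filter z hz, majR_filter z hz, add_sub_assoc]
    congr 3
    · congr 2
      rw [hzc, List.filter_filter]
      refine List.filter_congr fun x _ => ?_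
      rw [← Bool.decide_and, decide_eq_decide, kk_eq_one]
    · congr 2
      rw [List.filter_filter, hzc, List.filter_filter]
      refine List.filter_congr fun x hx => ?_
      rw [← Bool.decide_and, ← Bool.decide_and, decide_eq_decide, kk_eq_one]
      constructor
      · rintro ⟨h1, h2⟩
        exact ⟨⟨fun h' => hL.1 (h' ▸ h2), h1⟩, by simp [h2]⟩
      · rintro ⟨⟨h1, h2⟩, h3⟩
        exact ⟨h2, (List.mem_cons.1 h3).resolve_left h1⟩

theorem mkCol_mono {P : Finset Cell} (hP : IsMoon P) (ρ : List ℤ) (s : ℤ → ℕ) (L : List ℤ)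
    (hs : L.Pairwise fun c d => colLen P c ≤ colLen P d) (hL : ∀ c ∈ L, c ∈ colSet P) :
    Mono (L.map (mkCol P ρ s)) := by
  rw [Mono, List.pairwise_map]
  refine List.Pairwise.imp_of_mem ?_ hs
  intro c d hc hd h
  obtain ⟨r₀, hr₀⟩ := mem_colSet.1 (hL c hc)
  constructor
  · refine List.countP_mono_left fun r _ hr => ?_
    rw [decide_eq_true_eq, kk_eq_zero] at hr ⊢
    obtain ⟨h1, r', h2, h3⟩ := hr
    refine ⟨fun h' => h1 (hP.sub h h'), r₀, ?_, hr₀⟩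
    by_contra! hle
    exact h1 (hP.2.1 d r₀ r' r (hP.sub h hr₀) h3 hle h2.le)
  · refine List.countP_mono_left fun r _ hr => ?_
    rw [decide_eq_true_eq, kk_eq_two] at hr ⊢
    refine ⟨fun h' => hr.1 (hP.sub h h'), ?_⟩
    rintro ⟨r', h1, h2⟩
    exact hr.2 ⟨r', h1, hP.sub h h2⟩

noncomputable def colOf (M : Finset Cell) (r : ℤ) : ℤ := ∑ x ∈ M.filter (fun x => x.1 = r), x.2

theorem colOf_eq {M : Finset Cell} (hM : ∀ x ∈ M, ∀ y ∈ M, x.1 = y.1 → x = y) {x : Cell}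
    (hx : x ∈ M) : colOf M x.1 = x.2 := by
  have : M.filter (fun y => y.1 = x.1) = {x} := by
    ext y
    rw [Finset.mem_filter, Finset.mem_singleton]
    constructor
    · rintro ⟨h1, h2⟩
      exact hM y h1 x hx h2
    · rintro rfl; exact ⟨hx, rfl⟩
  rw [colOf, this, Finset.sum_singleton]

noncomputable def rho (P : Finset Cell) (A : Finset ℤ) : List ℤ := (rowSet P \ A).sort (· ≤ ·)

theorem rho_sorted (P : Finset Cell) (A : Finset ℤ) :
    (rho P A).Pairwise fun x y => x < y := (Finset.sortedLT_sort _).pairwise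

theorem mem_rho {P : Finset Cell} {A : Finset ℤ} {r : ℤ} :
    r ∈ rho P A ↔ r ∈ rowSet P ∧ r ∉ A := by
  rw [rho, Finset.mem_sort, Finset.mem_sdiff]

theorem mem_FillSet {P : Finset Cell} {s : ℤ → ℕ} {A : Finset ℤ} {M : Finset Cell} :
    M ∈ FillSet P s A ↔ M ⊆ P ∧ (∀ x ∈ M, ∀ y ∈ M, x.1 = y.1 → x = y) ∧
    (∀ c ∈ colSet P, (M.filter fun x => x.2 = c).card = s c) ∧
    (∀ r ∈ rowSet P, (r ∈ A ↔ ∀ x ∈ M, x.1 ≠ r)) := by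
  rw [FillSet, Finset.mem_filter, Finset.mem_powerset]

noncomputable def zOf (P : Finset Cell) (A : Finset ℤ) (M : Finset Cell) : List Cell :=
  (rho P A).map fun r => (r, colOf M r)

noncomputable def wordOf (P : Finset Cell) (A : Finset ℤ) (M : Finset Cell) : List ℤ :=
  (rho P A).map (colOf M)

theorem zOf_snd (P : Finset Cell) (A : Finset ℤ) (M : Finset Cell) :
    (zOf P A M).map Prod.snd = wordOf P A M := by
  rw [zOf, List.map_map]; rfl

theorem zOf_sorted (P : Finset Cell) (A : Finset ℤ) (M : Finset Cell) : RowSorted (zOf P A M) := by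
  rw [RowSorted, zOf, List.pairwise_map]
  exact rho_sorted P A

theorem zOf_toFinset {P : Finset Cell} {s : ℤ → ℕ} {A : Finset ℤ} {M : Finset Cell}
    (hM : M ∈ FillSet P s A) : (zOf P A M).toFinset = M := by
  obtain ⟨h1, h2, h3, h4⟩ := mem_FillSet.1 hM
  ext x
  rw [List.mem_toFinset, zOf, List.mem_map]
  constructor
  · rintro ⟨r, hr, rfl⟩
    rw [mem_rho] at hr
    have := (h4 r hr.1).not.1 hr.2
    push Not at this
    obtain ⟨x, hx, rfl⟩ := this
    rw [colOf_eq h2 hx]; exact hx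
  · intro hx
    refine ⟨x.1, ?_, ?_⟩
    · have hr : x.1 ∈ rowSet P := mem_rowSet.2 ⟨x.2, h1 hx⟩
      refine mem_rho.2 ⟨hr, fun hA => (h4 _ hr).1 hA x hx rfl⟩
    · rw [colOf_eq h2 hx]

theorem rowSorted_nodup {z : List Cell} (hz : RowSorted z) : z.Nodup :=
  hz.imp fun {a b} h hab => by rw [hab] at h; exact lt_irrefl _ h

theorem count_snd (z : List Cell) (hz : RowSorted z) (c : ℤ) :
    (z.map Prod.snd).count c = (z.toFinset.filter fun x => x.2 = c).card := by
  have : z.toFinset.filter (fun x => x.2 = c) = (z.filter fun x => decide (x.2 = c)).toFinset := by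
    ext x; simp
  rw [this, List.toFinset_card_of_nodup ((rowSorted_nodup hz).filter _), List.count,
    List.countP_map, List.countP_eq_length_filter]
  rfl

theorem good_wordOf {P : Finset Cell} (hP : IsMoon P) {s : ℤ → ℕ} {A : Finset ℤ}
    {M : Finset Cell} (hM : M ∈ FillSet P s A) (L : List ℤ) (hL : ∀ c, c ∈ L ↔ c ∈ colSet P) :
    Good (L.map (mkCol P (rho P A) s)) (wordOf P A M) := by
  have hz := zOf_toFinset hM
  have hmem : ∀ x, x ∈ zOf P A M ↔ x ∈ M := fun x => by
    rw [← List.mem_toFinset, hz]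
  obtain ⟨h1, h2, h3, h4⟩ := mem_FillSet.1 hM
  rw [← zOf_snd]
  refine ⟨?_, ?_⟩
  · intro c hc
    obtain ⟨x, hx, rfl⟩ := List.mem_map.1 hc
    rw [List.map_map]
    have : x.2 ∈ L := (hL _).2 (mem_colSet.2 ⟨x.1, h1 ((hmem x).1 hx)⟩)
    exact List.mem_map.2 ⟨x.2, this, rfl⟩
  · intro e he
    obtain ⟨c, hc, rfl⟩ := List.mem_map.1 he
    change _ = s c ∧ _
    have hlen : ∀ i, (((zOf P A M).filter (fun x => decide (kk P c x.1 = i))).map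
        Prod.snd).length = (rho P A).countP fun r => decide (kk P c r = i) := by
      intro i
      rw [List.length_map, ← List.countP_eq_length_filter, zOf, List.countP_map]
      rfl
    have hnot : ∀ i, i ≠ 1 → c ∉ ((zOf P A M).filter (fun x => decide (kk P c x.1 = i))).map
        Prod.snd := by
      intro i hi hcm
      obtain ⟨x, hx, rfl⟩ := List.mem_map.1 hcm
      rw [List.mem_filter, decide_eq_true_eq, hmem] at hx
      have : kk P x.2 x.1 = 1 := kk_eq_one.2 (h1 hx.1)
      omega
    refine ⟨?_, ?_⟩
    · change List.count c _ = _
      rw [count_snd _ (zOf_sorted P A M), hz]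
      exact h3 c ((hL c).1 hc)
    · refine ⟨_, ((zOf P A M).filter (fun x => decide (kk P c x.1 = 1))).map Prod.snd, _, ?_, hlen 0, hlen 2, hnot 0 (by omega), hnot 2 (by omega)⟩
      rw [← List.map_append, ← List.map_append, ← split_cells hP c _ (zOf_sorted P A M)]

theorem majP_wordOf {P : Finset Cell} (hP : IsMoon P) {s : ℤ → ℕ} {A : Finset ℤ}
    {M : Finset Cell} (hM : M ∈ FillSet P s A) (L : List ℤ) (hL : ∀ c, c ∈ L ↔ c ∈ colSet P)
    (hn : L.Nodup) (hs : L.Pairwise fun c d => colLen P c ≤ colLen P d) :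
    (majP P M : ℤ) = wmajZ (L.map (mkCol P (rho P A) s)) (wordOf P A M) := by
  have hz := zOf_toFinset hM
  have hmem : ∀ x, x ∈ zOf P A M ↔ x ∈ M := fun x => by
    rw [← List.mem_toFinset, hz]
  obtain ⟨h1, h2, h3, h4⟩ := mem_FillSet.1 hM
  have hself : (zOf P A M).filter (fun x => decide (x.2 ∈ L)) = zOf P A M := by
    rw [List.filter_eq_self]
    intro x hx
    rw [decide_eq_true_eq]
    exact (hL _).2 (mem_colSet.2 ⟨x.1, h1 ((hmem x).1 hx)⟩)
  have hlen : ∀ c i, (zOf P A M).countP (fun x => decide (kk P c x.1 = i)) =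
      (rho P A).countP fun r => decide (kk P c r = i) := by
    intro c i
    rw [zOf, List.countP_map]
    rfl
  have := tele_wmajZ hP (zOf P A M) (zOf_sorted P A M) (rho P A) s
    (fun x hx => h1 ((hmem x).1 hx)) L hn hs (by rw [hself]; exact fun c _ => hlen c 0)
    (by rw [hself]; exact fun c _ => hlen c 2)
  rw [hself, hz, zOf_snd] at this
  rw [← this, majP_eq_tele hP h1 h2 L hs hL]

theorem exists_filling {P : Finset Cell} (hP : IsMoon P) {s : ℤ → ℕ} {A : Finset ℤ}
    (L : List ℤ) (hL : ∀ c, c ∈ L ↔ c ∈ colSet P)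
    (w : List ℤ) (hw : Good (L.map (mkCol P (rho P A) s)) w) (hlen : w.length = (rho P A).length) :
    ∃ M ∈ FillSet P s A, wordOf P A M = w := by
  set z := (rho P A).zip w with hz
  have hz1 : z.map Prod.fst = rho P A := List.map_fst_zip (by omega)
  have hz2 : z.map Prod.snd = w := List.map_snd_zip (by omega)
  have hzs : RowSorted z := by
    have := rho_sorted P A
    rwa [← hz1, List.pairwise_map] at this
  have hzP : ∀ x ∈ z, x ∈ P := by
    rintro ⟨r, c⟩ hx
    have hcw : c ∈ w := by rw [← hz2]; exact List.mem_map.2 ⟨_, hx, rfl⟩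
    have := hw.1 c hcw
    rw [List.map_map] at this
    obtain ⟨c', hc', h⟩ := List.mem_map.1 this
    change c' = c at h
    subst h
    obtain ⟨_, u, m, v, rfl, hu, hv, hcu, hcv⟩ := hw.2 _ (List.mem_map_of_mem hc')
    change c' ∉ u at hcu
    change c' ∉ v at hcv
    have hsp := split_rows hP c' (rho P A) (rho_sorted P A)
    have hu' : ((rho P A).filter fun r => decide (kk P c' r = 0)).length = u.length := by
      rw [← List.countP_eq_length_filter]; exact hu.symm
    have hv' : ((rho P A).filter fun r => decide (kk P c' r = 2)).length = v.length := by
      rw [← List.countP_eq_length_filter]; exact hv.symm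
    have hm' : ((rho P A).filter fun r => decide (kk P c' r = 1)).length = m.length := by
      have := congrArg List.length hsp
      simp only [List.length_append] at this hlen
      omega
    rw [hz] at hx
    rw [hsp, List.zip_append (by simp only [List.length_append]; omega), List.zip_append hu',
      List.mem_append, List.mem_append] at hx
    rcases hx with (hx | hx) | hx
    · exact absurd (List.of_mem_zip hx).2 hcu
    · have := (List.of_mem_zip hx).1
      rw [List.mem_filter, decide_eq_true_eq, kk_eq_one] at this
      exact this.2
    · exact absurd (List.of_mem_zip hx).2 hcv
  have huniq : ∀ x ∈ z.toFinset, ∀ y ∈ z.toFinset, x.1 = y.1 → x = y := by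
    intro x hx y hy h
    rw [List.mem_toFinset] at hx hy
    have hnd : (z.map Prod.fst).Nodup := by
      rw [hz1]; exact (rho_sorted P A).imp fun {_ _} h => h.ne
    exact List.inj_on_of_nodup_map hnd hx hy h
  refine ⟨z.toFinset, ?_, ?_⟩
  · refine mem_FillSet.2 ⟨fun x hx => hzP x (List.mem_toFinset.1 hx), huniq, ?_, ?_⟩
    · intro c hc
      rw [← count_snd z hzs, hz2]
      exact (hw.2 _ (List.mem_map_of_mem ((hL c).2 hc))).1
    · intro r hr
      constructor
      · rintro hA x hx rfl
        have : x.1 ∈ rho P A := by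
          rw [← hz1]; exact List.mem_map.2 ⟨x, List.mem_toFinset.1 hx, rfl⟩
        exact (mem_rho.1 this).2 hA
      · intro h
        by_contra hA
        have : r ∈ rho P A := mem_rho.2 ⟨hr, hA⟩
        rw [← hz1] at this
        obtain ⟨x, hx, rfl⟩ := List.mem_map.1 this
        exact h x (List.mem_toFinset.2 hx) rfl
  · rw [wordOf, ← hz1, List.map_map]
    conv_rhs => rw [← hz2]
    refine List.map_congr_left fun x hx => ?_
    exact colOf_eq huniq (List.mem_toFinset.2 hx)

open LaurentPolynomial in
theorem gf_FillSet {P : Finset Cell} (hP : IsMoon P) (s : ℤ → ℕ) (A : Finset ℤ)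
    (L : List ℤ) (hL : ∀ c, c ∈ L ↔ c ∈ colSet P)
    (hn : L.Nodup) (hs : L.Pairwise fun c d => colLen P c ≤ colLen P d) :
    ∑ M ∈ FillSet P s A, (T (majP P M : ℤ) : LaurentPolynomial ℤ) =
      if (rho P A).length = tot (L.map (mkCol P (rho P A) s)) then
        gf (L.map (mkCol P (rho P A) s)) else 0 := by
  have hmono := mkCol_mono hP (rho P A) s L hs fun c hc => (hL c).1 hc
  have hnd : ((L.map (mkCol P (rho P A) s)).map Col.c).Nodup := by
    rw [List.map_map]
    have : L.map (Col.c ∘ mkCol P (rho P A) s) = L := by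
      conv_rhs => rw [← List.map_id L]
      rfl
    rwa [this]
  split_ifs with hlen
  · rw [← sum_WS _ hnd hmono]
    refine Finset.sum_nbij (wordOf P A) ?_ ?_ ?_ ?_
    · intro M hM
      rw [mem_WS _ hnd hmono]
      exact good_wordOf hP hM L hL
    · intro M hM M' hM' h
      rw [Finset.mem_coe] at hM hM'
      rw [← zOf_toFinset hM, ← zOf_toFinset hM']
      congr 1
      rw [wordOf, wordOf, List.map_inj_left] at h
      rw [zOf, zOf, List.map_inj_left]
      intro r hr
      rw [h r hr]
    · intro w hw
      rw [Finset.mem_coe, mem_WS _ hnd hmono] at hw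
      have := length_eq_tot _ hnd w hw.1 fun e he => (hw.2 e he).1
      obtain ⟨M, hM, h⟩ := exists_filling hP L hL w hw (by omega)
      exact ⟨M, hM, h⟩
    · intro M hM
      rw [majP_wordOf hP hM L hL hn hs]
  · apply Finset.sum_eq_zero
    intro M hM
    exfalso
    apply hlen
    have hw := good_wordOf hP hM L hL
    rw [← length_eq_tot _ hnd _ hw.1 fun e he => (hw.2 e he).1, wordOf, List.length_map]

theorem exists_sorted (S : Finset ℤ) (f : ℤ → ℕ) :
    ∃ l : List ℤ, l.Nodup ∧ (∀ c, c ∈ l ↔ c ∈ S) ∧ l.Pairwise fun c d => f c ≤ f d := by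
  induction hn : S.card generalizing S with
  | zero => exact ⟨[], List.nodup_nil, by rw [Finset.card_eq_zero.1 hn]; simp, List.Pairwise.nil⟩
  | succ n ih =>
    have hne : S.Nonempty := Finset.card_pos.1 (by omega)
    obtain ⟨x, hx, hmin⟩ := S.exists_min_image f hne
    obtain ⟨l, h1, h2, h3⟩ := ih (S.erase x) (by rw [Finset.card_erase_of_mem hx]; omega)
    refine ⟨x :: l, ?_, ?_, ?_⟩
    · rw [List.nodup_cons, h2]
      exact ⟨Finset.notMem_erase _ _, h1⟩
    · intro c
      rw [List.mem_cons, h2, ← Finset.mem_insert, Finset.insert_erase hx]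
    · rw [List.pairwise_cons]
      exact ⟨fun a ha => hmin a (Finset.mem_of_mem_erase ((h2 a).1 ha)), h3⟩

theorem card_rowSet {P : Finset Cell} (hP : IsMoon P) {c : ℤ}
    (hmax : ∀ d ∈ colSet P, colLen P d ≤ colLen P c) : (rowSet P).card = colLen P c := by
  rw [← card_colRows]
  congr 1
  ext r
  rw [mem_rowSet, mem_colRows]
  constructor
  · rintro ⟨d, hd⟩
    exact hP.sub (hmax d (mem_colSet.2 ⟨r, hd⟩)) hd
  · exact fun h => ⟨c, h⟩

theorem rowLen_eq (P : Finset Cell) (r : ℤ) :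
    rowLen P r = ((colSet P).filter fun d => (r, d) ∈ P).card := by
  have : (colSet P).filter (fun d => (r, d) ∈ P) = (P.filter fun x => x.1 = r).image Prod.snd := by
    ext d
    rw [Finset.mem_filter, mem_colSet, Finset.mem_image]
    constructor
    · rintro ⟨_, h⟩
      exact ⟨(r, d), by simp [h], rfl⟩
    · rintro ⟨⟨a, b⟩, h, rfl⟩
      rw [Finset.mem_filter] at h
      obtain ⟨h1, h2⟩ := h
      simp only at h2
      subst h2
      exact ⟨⟨a, h1⟩, h1⟩
  rw [this, rowLen, Finset.card_image_of_injOn]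
  rintro ⟨a, b⟩ hx ⟨a', b'⟩ hy h
  simp at hx hy h
  ext <;> simp [h, hx.2, hy.2]

theorem mem_iff_rowLen {P : Finset Cell} (hP : IsMoon P) {c r : ℤ} (hc : c ∈ colSet P) :
    (r, c) ∈ P ↔ ((colSet P).filter fun d => colLen P c ≤ colLen P d).card ≤ rowLen P r := by
  rw [rowLen_eq]
  constructor
  · intro h
    refine Finset.card_le_card fun d hd => ?_
    rw [Finset.mem_filter] at hd ⊢
    exact ⟨hd.1, hP.sub hd.2 h⟩
  · intro h
    by_contra hr
    refine absurd h (not_le.2 (Finset.card_lt_card ?_))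
    rw [Finset.ssubset_iff_of_subset]
    · exact ⟨c, by simp [hc], by simp [hr]⟩
    · intro d hd
      rw [Finset.mem_filter] at hd ⊢
      refine ⟨hd.1, ?_⟩
      by_contra! hlt
      exact hr (hP.sub hlt.le hd.2)

theorem length_rho {P : Finset Cell} {A : Finset ℤ} (hA : A ⊆ rowSet P) :
    (rho P A).length + A.card = (rowSet P).card := by
  rw [rho, Finset.length_sort, Finset.card_sdiff_add_card_eq_card hA]

theorem mkCol_at {P : Finset Cell} {A : Finset ℤ} (hA : A ⊆ rowSet P) (s : ℤ → ℕ) (c : ℤ) :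
    (mkCol P (rho P A) s c).a + (mkCol P (rho P A) s c).t + colLen P c + A.card =
      (rowSet P).card + (A.filter fun r => (r, c) ∈ P).card := by
  have h1 : ∀ l : List ℤ, l.countP (fun r => decide (kk P c r = 0)) +
      l.countP (fun r => decide (kk P c r = 2)) + l.countP (fun r => decide ((r, c) ∈ P)) =
      l.length := by
    intro l
    induction l with
    | nil => rfl
    | cons x l ih =>
      have h012 : kk P c x = 0 ∨ kk P c x = 1 ∨ kk P c x = 2 := by
        have := kk_le P c x; omega
      have hk := @kk_eq_one P c x
      simp only [List.countP_cons, ← hk, List.length_cons]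
      rcases h012 with h | h | h <;> simp [h] <;> omega
  have h2 : (rho P A).countP (fun r => decide ((r, c) ∈ P)) +
      (A.filter fun r => (r, c) ∈ P).card = colLen P c := by
    have hnd : (rho P A).Nodup := (rho_sorted P A).imp fun {_ _} h => h.ne
    rw [List.countP_eq_length_filter, ← List.toFinset_card_of_nodup (hnd.filter _),
      ← card_colRows, ← Finset.card_union_of_disjoint]
    · congr 1
      ext r
      simp only [Finset.mem_union, List.mem_toFinset, List.mem_filter, decide_eq_true_eq,
        Finset.mem_filter, mem_colRows, mem_rho]
      constructor
      · rintro (h | h) <;> exact h.2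
      · intro h
        by_cases hr : r ∈ A
        · exact Or.inr ⟨hr, h⟩
        · exact Or.inl ⟨⟨mem_rowSet.2 ⟨c, h⟩, hr⟩, h⟩
    · rw [Finset.disjoint_left]
      intro r hr hr'
      simp only [List.mem_toFinset, List.mem_filter, mem_rho] at hr
      exact hr.1.2 (Finset.mem_filter.1 hr').1
  have h3 := h1 (rho P A)
  have h4 := length_rho hA
  change List.countP _ _ + List.countP _ _ + _ + _ = _
  omega

/-- **Theorem (STATEMENT 3).** If the moon polyomino `Q` is obtained from the moon
polyomino `P` by permuting its columns (via a length-preserving bijection `σ` from the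
columns of `Q` to those of `P`), `s' = s ∘ σ`, and `A'` is a set of rows of `Q` whose
multiset of row lengths equals that of `A`, then the generating functions of the major
index over `F(P,s;A)` and over `F(Q,s';A')` coincide: the generating function does not
depend on the order of the columns. -/
theorem maj_generating_function_column_permutation
    (P Q : Finset Cell) (hP : IsMoon P) (hQ : IsMoon Q)
    (σ : ℤ → ℤ) (hinj : Set.InjOn σ (colSet Q)) (himg : (colSet Q).image σ = colSet P)
    (hlen : ∀ c ∈ colSet Q, colLen Q c = colLen P (σ c))
    (s : ℤ → ℕ) (A A' : Finset ℤ) (hA : A ⊆ rowSet P) (hA' : A' ⊆ rowSet Q)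
    (hrows : A.val.map (fun r => rowLen P r) = A'.val.map (fun r => rowLen Q r)) :
    ∑ M ∈ FillSet P s A, (Polynomial.X : Polynomial ℤ) ^ majP P M
      = ∑ N ∈ FillSet Q (fun c => s (σ c)) A', (Polynomial.X : Polynomial ℤ) ^ majP Q N := by
  obtain ⟨l, hl1, hl2, hl3⟩ := exists_sorted (colSet Q) (colLen Q)
  have hσ : ∀ c ∈ colSet Q, σ c ∈ colSet P := fun c hc => by
    rw [← himg]; exact Finset.mem_image_of_mem _ hc
  have hcard : A.card = A'.card := by
    have := congrArg Multiset.card hrows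
    simpa using this
  have hrs : (rowSet P).card = (rowSet Q).card := by
    rcases (colSet Q).eq_empty_or_nonempty with h | h
    · have hPe : colSet P = ∅ := by rw [← himg, h, Finset.image_empty]
      rw [colSet, Finset.image_eq_empty] at h hPe
      rw [h, hPe]
    · obtain ⟨c, hc, hmax⟩ := (colSet Q).exists_max_image (colLen Q) h
      rw [card_rowSet hQ hmax, card_rowSet hP (c := σ c), hlen c hc]
      intro d hd
      rw [← himg, Finset.mem_image] at hd
      obtain ⟨d, hd, rfl⟩ := hd
      rw [← hlen c hc, ← hlen d hd]
      exact hmax d hd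
  have hN : ∀ c ∈ colSet Q, ((colSet P).filter fun d => colLen P (σ c) ≤ colLen P d).card =
      ((colSet Q).filter fun d => colLen Q c ≤ colLen Q d).card := by
    intro c hc
    rw [← himg, Finset.filter_image, Finset.card_image_of_injOn
      (hinj.mono fun x hx => (Finset.mem_filter.1 hx).1)]
    congr 1
    refine Finset.filter_congr fun d hd => ?_
    rw [hlen c hc, hlen d hd]
  have hAc : ∀ c ∈ colSet Q, (A.filter fun r => (r, σ c) ∈ P).card =
      (A'.filter fun r => (r, c) ∈ Q).card := by
    intro c hc
    have e1 : A.filter (fun r => (r, σ c) ∈ P) = A.filter fun r =>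
        ((colSet Q).filter fun d => colLen Q c ≤ colLen Q d).card ≤ rowLen P r := by
      refine Finset.filter_congr fun r _ => ?_
      rw [mem_iff_rowLen hP (hσ c hc), hN c hc]
    have e2 : A'.filter (fun r => (r, c) ∈ Q) = A'.filter fun r =>
        ((colSet Q).filter fun d => colLen Q c ≤ colLen Q d).card ≤ rowLen Q r := by
      refine Finset.filter_congr fun r _ => ?_
      rw [mem_iff_rowLen hQ hc]
    rw [e1, e2]
    have := congrArg (Multiset.countP fun n =>
      ((colSet Q).filter fun d => colLen Q c ≤ colLen Q d).card ≤ n) hrows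
    rwa [Multiset.countP_map, Multiset.countP_map] at this
  have gP := gf_FillSet hP s A (l.map σ)
    (by
      intro c
      rw [← himg, Finset.mem_image, List.mem_map]
      simp only [hl2])
    (hl1.map_on fun x hx y hy h => hinj ((hl2 x).1 hx) ((hl2 y).1 hy) h)
    (by
      rw [List.pairwise_map]
      refine List.Pairwise.imp_of_mem ?_ hl3
      intro c d hc hd h
      rwa [← hlen c ((hl2 c).1 hc), ← hlen d ((hl2 d).1 hd)])
  have gQ := gf_FillSet hQ (fun c => s (σ c)) A' l hl2 hl1 hl3
  have hr1 := length_rho hA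
  have hr2 := length_rho hA'
  have hgf := gf_congr (fun c => mkCol P (rho P A) s (σ c))
    (mkCol Q (rho Q A') (fun c => s (σ c))) (fun _ => rfl) l (by
      intro c hc
      have hc := (hl2 c).1 hc
      have h1 := mkCol_at hA s (σ c)
      have h2 := mkCol_at hA' (fun c => s (σ c)) c
      have h3 := hAc c hc
      have h4 := hlen c hc
      omega)
  have htot : tot (l.map fun c => mkCol P (rho P A) s (σ c)) =
      tot (l.map (mkCol Q (rho Q A') (fun c => s (σ c)))) := by
    simp only [tot, List.map_map]
    rfl
  have hrr : (rho P A).length = (rho Q A').length := by omega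
  rw [List.map_map] at gP
  change _ = if _ = tot (l.map fun c => mkCol P (rho P A) s (σ c)) then
    gf (l.map fun c => mkCol P (rho P A) s (σ c)) else 0 at gP
  rw [hgf, htot, hrr, ← gQ] at gP
  apply Polynomial.toLaurent_injective
  rw [map_sum, map_sum]
  simpa only [Polynomial.toLaurent_X_pow] using gP

end MoonPolyomino
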